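/- arXiv:1306.4628 — 2 statements merged into one kernel-verified Lean document; each statement's English description precedes it below -/
import Mathlib

section
/- For every integer n ≥ 4, if p₀(n) denotes the total number of set partitions of {1,…,n} of genus 1 (with any number of blocks), then 6·(n−4)!·(n−3)!·p₀(n) = (2n−5)!. -/
/-- The setoid on `Fin n` whose equivalence classes are the cycles (orbits) of the
permutation `α`. -/
def cycleSetoid {n : ℕ} (α : Equiv.Perm (Fin n)) : Setoid (Fin n) :=
  ⟨α.SameCycle,
    ⟨fun x => Equiv.Perm.SameCycle.refl α x, fun h => h.symm, fun h h' => h.trans h'⟩⟩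

/-- `zPerm α` is the number of cycles of `α`, i.e. the number of orbits of `⟨α⟩` acting
on `Fin n` (fixed points counting as cycles). -/
noncomputable def zPerm {n : ℕ} (α : Equiv.Perm (Fin n)) : ℕ :=
  Nat.card (Quotient (cycleSetoid α))

/-- `α` has genus one, i.e. `z(α) + z(α⁻¹ ∘ ζₙ) = n - 1` (written additively).
Here `finRotate n` plays the role of the cycle `ζₙ = (1, 2, …, n)`. -/
def IsGenusOne {n : ℕ} (α : Equiv.Perm (Fin n)) : Prop :=
  zPerm α + zPerm (α⁻¹ * finRotate n) + 2 = n + 1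

/-- `i` is a back point of `α`: `α i < i` and `α i` is not the smallest element of the
cycle (orbit) of `α` containing `i`. -/
def IsBackPoint {n : ℕ} (α : Equiv.Perm (Fin n)) (i : Fin n) : Prop :=
  α i < i ∧ ∃ j : Fin n, α.SameCycle i j ∧ j < α i

/-- The number of back points of `α`. -/
noncomputable def backPointCount {n : ℕ} (α : Equiv.Perm (Fin n)) : ℕ :=
  Nat.card {i : Fin n // IsBackPoint α i}

/-- `α` is the permutation associated with a set partition (each block of the partition
is a cycle of `α`, traversed in increasing order); equivalently, `α` has no back point. -/
def IsPartitionPerm {n : ℕ} (α : Equiv.Perm (Fin n)) : Prop :=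
  ∀ i : Fin n, ¬ IsBackPoint α i

section WalkCounts

/-- `stableWalks r i` counts the genus-preserving ways to add `r` more points to a partition with
`i + 1` accessible blocks, when only the number of accessible blocks matters. -/
def stableWalks : ℕ → ℕ → ℕ
  | 0, _ => 1
  | r + 1, i => ∑ j ∈ Finset.range (i + 2), stableWalks r j

/-- `pendingWalks r i c` counts the ways to add `r` more points to a genus-zero partition with
`i + 1` accessible blocks so that the genus is raised exactly once, by opening a prescribed
inaccessible face containing `c` blocks. -/
def pendingWalks : ℕ → ℕ → ℕ → ℕ
  | 0, _, _ => 0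
  | r + 1, i, c =>
      c * stableWalks r (i + c) + ∑ j ∈ Finset.range (i + 2), pendingWalks r j c

/-- `freeWalks r i` counts the ways to add `r` more points to a genus-zero partition with
`i + 1` accessible blocks so that the genus is raised exactly once, by opening a face
which was closed during these `r` steps. -/
def freeWalks : ℕ → ℕ → ℕ
  | 0, _ => 0
  | r + 1, i => ∑ j ∈ Finset.range (i + 2), freeWalks r j +
      ∑ j ∈ Finset.range (i + 1), pendingWalks r j (i - j)

open PowerSeries in
lemma eq_of_walk_recurrence {f g s : ℕ → ℚ⟦X⟧}
    (hf : ∀ i, f i = s i + X * ∑ j ∈ Finset.range (i + 2), f j)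
    (hg : ∀ i, g i = s i + X * ∑ j ∈ Finset.range (i + 2), g j) (i : ℕ) : f i = g i := by
  ext r
  induction r generalizing i with
  | zero => rw [hf, hg]; simp
  | succ r ih =>
    rw [hf, hg, map_add, map_add, coeff_succ_X_mul, coeff_succ_X_mul, map_sum, map_sum]
    simp [ih]

open PowerSeries in
lemma mk_walk_recurrence {a : ℕ → ℕ → ℚ} {b : ℕ → ℕ → ℚ}
    (h0 : ∀ i, a 0 i = b 0 i)
    (h : ∀ r i, a (r + 1) i = b (r + 1) i + ∑ j ∈ Finset.range (i + 2), a r j) (i : ℕ) :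
    mk (fun r => a r i) = mk (fun r => b r i) +
      X * ∑ j ∈ Finset.range (i + 2), mk (fun r => a r j) := by
  ext r
  cases r with
  | zero => simp [h0]
  | succ r => simp [h, coeff_succ_X_mul]

open PowerSeries in
lemma exists_catalan_parametrization : ∃ C y I : ℚ⟦X⟧,
    (X : ℚ⟦X⟧) = y * (1 - y) ∧ C * (1 - y) = 1 ∧ I * (1 - 2 * y) = 1 := by
  set C : ℚ⟦X⟧ := catalanSeries.map (Nat.castRingHom ℚ) with hC
  have h : C ^ 2 * X + 1 = C := by
    have := congrArg (PowerSeries.map (Nat.castRingHom ℚ)) catalanSeries_sq_mul_X_add_one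
    simpa using this
  have hy : C * (1 - X * C) = 1 := by linear_combination -h
  refine ⟨C, X * C, (1 - 2 * (X * C))⁻¹, ?_, hy, ?_⟩
  · linear_combination -X * hy
  · rw [mul_comm]
    exact PowerSeries.mul_inv_cancel _ (by simp)

open PowerSeries in
lemma sum_range_stable_closed {C y : ℚ⟦X⟧} (hX : (X : ℚ⟦X⟧) = y * (1 - y))
    (hC : C * (1 - y) = 1) (m : ℕ) :
    X * ∑ j ∈ Finset.range m, C ^ (j + 2) = C ^ m - 1 := by
  induction m with
  | zero => simp
  | succ m ih =>
    rw [Finset.sum_range_succ, mul_add, ih, hX]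
    linear_combination (C ^ m * (y * C - 1)) * hC

open PowerSeries in
lemma mk_stableWalks {C y : ℚ⟦X⟧} (hX : (X : ℚ⟦X⟧) = y * (1 - y))
    (hC : C * (1 - y) = 1) (i : ℕ) :
    mk (fun r => (stableWalks r i : ℚ)) = C ^ (i + 2) := by
  refine eq_of_walk_recurrence (f := fun i => mk (fun r => (stableWalks r i : ℚ)))
    (g := fun i => C ^ (i + 2)) (s := fun _ => 1) (fun i => ?_) (fun i => ?_) i
  · have := mk_walk_recurrence (a := fun r i => (stableWalks r i : ℚ))
      (b := fun r _ => if r = 0 then 1 else 0) (by simp [stableWalks])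
      (by simp [stableWalks]) i
    rw [this]
    congr 1
    ext r
    simp [coeff_one]
  · have := sum_range_stable_closed hX hC (i + 2)
    linear_combination -this

open PowerSeries in
lemma mk_pendingWalks {C y I : ℚ⟦X⟧} (hX : (X : ℚ⟦X⟧) = y * (1 - y))
    (hC : C * (1 - y) = 1) (hI : I * (1 - 2 * y) = 1) (i c : ℕ) :
    mk (fun r => (pendingWalks r i c : ℚ)) =
      c * y * (1 - y) ^ 2 * I * C ^ (c + 2) * ((i + 1) * C ^ (i + 1) - i * C ^ i) := by
  refine eq_of_walk_recurrence (f := fun i => mk (fun r => (pendingWalks r i c : ℚ)))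
    (g := fun i => (c : ℚ⟦X⟧) * y * (1 - y) ^ 2 * I * C ^ (c + 2) *
      ((i + 1) * C ^ (i + 1) - i * C ^ i))
    (s := fun i => X * ((c : ℚ⟦X⟧) * C ^ (i + c + 2))) (fun i => ?_) (fun i => ?_) i
  · have := mk_walk_recurrence (a := fun r i => (pendingWalks r i c : ℚ))
      (b := fun r i => if r = 0 then 0 else c * stableWalks (r - 1) (i + c))
      (by simp [pendingWalks]) (by simp [pendingWalks]) i
    rw [this, ← mk_stableWalks hX hC]
    congr 1
    ext r
    cases r with
    | zero => simp
    | succ r =>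
      rw [coeff_succ_X_mul, coeff_mk, ← map_natCast (PowerSeries.C (R := ℚ)), coeff_C_mul]
      simp
  · have h : ∀ m : ℕ, ∑ j ∈ Finset.range m, (c : ℚ⟦X⟧) * y * (1 - y) ^ 2 * I * C ^ (c + 2) *
        (((j : ℚ⟦X⟧) + 1) * C ^ (j + 1) - j * C ^ j) =
          c * y * (1 - y) ^ 2 * I * C ^ (c + 2) * (m * C ^ m) := by
      intro m
      induction m with
      | zero => simp
      | succ m ih => rw [Finset.sum_range_succ, ih]; push_cast; ring
    rw [h, hX]
    push_cast
    have key : (1 - y) ^ 2 * I * (((i : ℚ⟦X⟧) + 1) * C - i) =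
        (1 - y) + (1 - y) ^ 2 * I * (y * (1 - y) * ((i + 2) * C ^ 2)) := by
      linear_combination ((1 - y) * I * (i + 1) -
        (1 - y) * I * y * (i + 2) * (C * (1 - y) + 1)) * hC + (1 - y) * hI
    linear_combination (c : ℚ⟦X⟧) * y * C ^ (c + 2) * C ^ i * key

open PowerSeries in
/-- The closed form of `24` times the generating function of
`∑ j ∈ range i, freeWalks r j`. -/
noncomputable def freeWalksSum (C y I : ℚ⟦X⟧) (k : ℕ) : ℚ⟦X⟧ :=
  y ^ 2 * (1 - y) * I ^ 5 * (y * (1 - 2 * y) ^ 3 * (k * (k - 1) * (k - 2) * (k - 3)) +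
    4 * ((1 - y - y ^ 2) * (1 - 2 * y) ^ 2) * (k * (k - 1) * (k - 2)) +
    12 * ((1 - y) ^ 3 * (1 - 2 * y)) * (k * (k - 1)) + 24 * (y * (1 - y) ^ 3) * k) * C ^ k

open PowerSeries in
lemma mk_freeWalks {C y I : ℚ⟦X⟧} (hX : (X : ℚ⟦X⟧) = y * (1 - y))
    (hC : C * (1 - y) = 1) (hI : I * (1 - 2 * y) = 1) (i : ℕ) :
    24 * mk (fun r => (freeWalks r i : ℚ)) =
      freeWalksSum C y I (i + 1) - freeWalksSum C y I i := by
  refine eq_of_walk_recurrence (f := fun i => 24 * mk (fun r => (freeWalks r i : ℚ)))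
    (g := fun i => freeWalksSum C y I (i + 1) - freeWalksSum C y I i)
    (s := fun i => 24 * (X * ∑ j ∈ Finset.range (i + 1),
      mk (fun r => (pendingWalks r j (i - j) : ℚ)))) (fun i => ?_) (fun i => ?_) i
  · have := mk_walk_recurrence (a := fun r i => (freeWalks r i : ℚ))
      (b := fun r i => if r = 0 then 0 else
        ∑ j ∈ Finset.range (i + 1), (pendingWalks (r - 1) j (i - j) : ℚ))
      (by simp [freeWalks]) (by simp [freeWalks, add_comm]) i
    rw [this, ← Finset.mul_sum, mul_add]
    congr 1
    · congr 1
      ext r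
      cases r with
      | zero => simp
      | succ r => simp [coeff_succ_X_mul]
    · ring
  · have hs : ∀ m : ℕ, m ≤ i + 1 → 6 * ∑ j ∈ Finset.range m,
        mk (fun r => (pendingWalks r j (i - j) : ℚ)) =
          y * (1 - y) ^ 2 * I * C ^ (i + 2) * ((m * (m + 1) * (3 * i - 2 * m + 2)) * C -
            (m * (m - 1) * (3 * i - 2 * m + 1))) := by
      intro m hm
      induction m with
      | zero => simp
      | succ m ih =>
        rw [Finset.sum_range_succ, mul_add, ih (by omega), mk_pendingWalks hX hC hI]
        obtain ⟨d, rfl⟩ : ∃ d, i = m + d := ⟨i - m, by omega⟩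
        rw [Nat.add_sub_cancel_left]
        push_cast
        ring
    have hR : ∑ j ∈ Finset.range (i + 2),
        (freeWalksSum C y I (j + 1) - freeWalksSum C y I j) = freeWalksSum C y I (i + 2) := by
      rw [Finset.sum_range_sub]; simp [freeWalksSum]
    rw [hR]
    have hsum := hs (i + 1) le_rfl
    have hC2 : C ^ 2 * (1 - y) ^ 2 = 1 := by linear_combination (C * (1 - y) + 1) * hC
    have hI5 : I = I ^ 5 * (1 - 2 * y) ^ 4 := by
      linear_combination -(I * ((I * (1 - 2 * y)) ^ 3 + (I * (1 - 2 * y)) ^ 2 +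
        I * (1 - 2 * y) + 1)) * hI
    set S := ∑ j ∈ Finset.range (i + 1), mk (fun r => (pendingWalks r j (i - j) : ℚ))
    set Q : ℚ⟦X⟧ → ℚ⟦X⟧ := fun k => y ^ 2 * (1 - y) * I ^ 5 *
      (y * (1 - 2 * y) ^ 3 * (k * (k - 1) * (k - 2) * (k - 3)) +
      4 * ((1 - y - y ^ 2) * (1 - 2 * y) ^ 2) * (k * (k - 1) * (k - 2)) +
      12 * ((1 - y) ^ 3 * (1 - 2 * y)) * (k * (k - 1)) + 24 * (y * (1 - y) ^ 3) * k) with hQ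
    have hF (k : ℕ) : freeWalksSum C y I k = Q k * C ^ k := rfl
    rw [hF, hF, hF]
    push_cast at hsum ⊢
    set t : ℚ⟦X⟧ := (i : ℚ⟦X⟧)
    have hker : Q (t + 1) - (1 - y) * Q t - y * Q (t + 2) =
        4 * y ^ 2 * (1 - y) * (I ^ 5 * (1 - 2 * y) ^ 4) *
          ((t + 2) * (t + 1) * t - (1 - y) * ((t + 1) * t * (t - 1))) := by
      rw [hQ]; ring
    rw [← hI5] at hker
    have hmain : Q (t + 1) * C - Q t = 4 * y ^ 2 * (1 - y) ^ 3 * I * C ^ 2 *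
        ((t + 2) * (t + 1) * t * C - (t + 1) * t * (t - 1)) +
          y * (1 - y) * Q (t + 2) * C ^ 2 := by
      clear_value Q
      linear_combination C * hker + (Q t - y * C * Q (t + 2) -
          4 * y ^ 2 * (1 - y) * I * ((t + 1) * t * (t - 1))) * hC -
        4 * y ^ 2 * (1 - y) * I * ((t + 2) * (t + 1) * t * C - (t + 1) * t * (t - 1)) * hC2
    clear_value Q S
    rw [hX]
    linear_combination C ^ i * hmain - 4 * y * (1 - y) * hsum

open PowerSeries in
lemma mk_freeWalks_zero {C y I : ℚ⟦X⟧} (hX : (X : ℚ⟦X⟧) = y * (1 - y))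
    (hC : C * (1 - y) = 1) (hI : I * (1 - 2 * y) = 1) :
    mk (fun r => (freeWalks r 0 : ℚ)) = X ^ 3 * I ^ 5 := by
  have h := mk_freeWalks hX hC hI 0
  have h24 : (24 : ℚ⟦X⟧) ≠ 0 := by
    rw [← map_ofNat (PowerSeries.C (R := ℚ)) 24]
    simp
  apply mul_left_cancel₀ h24
  rw [h, hX]
  simp only [freeWalksSum]
  push_cast
  linear_combination 24 * y ^ 3 * (1 - y) ^ 3 * I ^ 5 * hC

open PowerSeries in
lemma coeff_inv_sqrt_pow_five {C y I : ℚ⟦X⟧} (hX : (X : ℚ⟦X⟧) = y * (1 - y))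
    (hC : C * (1 - y) = 1) (hI : I * (1 - 2 * y) = 1) (m : ℕ) :
    6 * (m.factorial : ℚ) * (m + 1).factorial * coeff m (I ^ 5) = (2 * m + 3).factorial := by
  have hsq : I ^ 2 * (1 - 4 * X) = 1 := by
    rw [hX]; linear_combination (I * (1 - 2 * y) + 1) * hI
  have hI0 : I ≠ 0 := fun h => by simp [h] at hI
  have hd : d⁄dX ℚ I * (1 - 4 * X) = 2 * I := by
    have h := congrArg (d⁄dX ℚ) hsq
    have h4 : d⁄dX ℚ (4 : ℚ⟦X⟧) = 0 := (d⁄dX ℚ).map_natCast 4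
    simp [Derivation.leibniz_pow, h4] at h
    have h2 : (2 * I) * (d⁄dX ℚ I * (1 - 4 * X)) = (2 * I) * (2 * I) := by
      linear_combination h
    refine mul_left_cancel₀ (mul_ne_zero ?_ hI0) h2
    rw [← map_ofNat (PowerSeries.C (R := ℚ)) 2]
    simp
  have hf : d⁄dX ℚ (I ^ 5) = 4 * (X * d⁄dX ℚ (I ^ 5)) + 10 * I ^ 5 := by
    simp [Derivation.leibniz_pow]
    linear_combination 5 * I ^ 4 * hd
  have hrec (m : ℕ) : ((m : ℚ) + 1) * coeff (m + 1) (I ^ 5) =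
      (4 * m + 10) * coeff m (I ^ 5) := by
    have h := congrArg (coeff m) hf
    rw [← map_ofNat (PowerSeries.C (R := ℚ)) 4, ← map_ofNat (PowerSeries.C (R := ℚ)) 10,
      map_add, coeff_C_mul, coeff_C_mul, coeff_derivative] at h
    cases m with
    | zero => simp at h ⊢; linarith
    | succ m =>
      rw [coeff_succ_X_mul, coeff_derivative] at h
      push_cast at h ⊢
      linarith
  induction m with
  | zero =>
    have hy : constantCoeff I = 1 := by
      have hX0 := congrArg constantCoeff hX
      have hC0 := congrArg constantCoeff hC
      have hI1 := congrArg constantCoeff hI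
      have h2 : constantCoeff (2 : ℚ⟦X⟧) = 2 := map_ofNat _ 2
      simp only [map_mul, map_sub, map_one, constantCoeff_X, h2] at hX0 hC0 hI1
      have hy0 : constantCoeff y = 0 := by
        linear_combination -constantCoeff C * hX0 - constantCoeff y * hC0
      simpa [hy0] using hI1
    simp [hy, Nat.factorial]
  | succ m ih =>
    have h := hrec m
    rw [show 2 * (m + 1) + 3 = 2 * m + 3 + 1 + 1 by ring, Nat.factorial_succ (2 * m + 3 + 1),
      Nat.factorial_succ (2 * m + 3), Nat.factorial_succ (m + 1)]
    push_cast
    rw [← ih, Nat.factorial_succ m]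
    push_cast
    linear_combination (6 * (m.factorial : ℚ) * (m + 1) * m.factorial * (m + 2)) * h

theorem freeWalks_closed (m : ℕ) :
    6 * m.factorial * (m + 1).factorial * freeWalks (m + 3) 0 = (2 * m + 3).factorial := by
  obtain ⟨C, y, I, hX, hC, hI⟩ := exists_catalan_parametrization
  have h := congrArg (PowerSeries.coeff (m + 3)) (mk_freeWalks_zero hX hC hI)
  rw [PowerSeries.coeff_mk, PowerSeries.coeff_X_pow_mul] at h
  have := coeff_inv_sqrt_pow_five hX hC hI m
  rw [← h] at this
  exact_mod_cast this

end WalkCounts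

section Insertion

open Equiv

/-- A permutation of `ℕ` without back points. -/
def NoBackPoint (α : Perm ℕ) : Prop :=
  ∀ i, ¬ (α i < i ∧ ∃ j, α.SameCycle i j ∧ j < α i)

open Classical in
/-- The elements of `{0, …, n - 1}` which are the minimum of their cycle. -/
noncomputable def cycleMins (n : ℕ) (α : Perm ℕ) : Finset ℕ :=
  (Finset.range n).filter fun i => ∀ j, α.SameCycle i j → i ≤ j

lemma mem_cycleMins {n : ℕ} {α : Perm ℕ} {i : ℕ} :
    i ∈ cycleMins n α ↔ i < n ∧ ∀ j, α.SameCycle i j → i ≤ j := by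
  simp [cycleMins]

lemma sameCycle_imp_of_forall_apply {X : Type*} {f : Perm X} {s : Setoid X}
    (h : ∀ x, s x (f x)) {x y : X} (hxy : f.SameCycle x y) : s x y := by
  have hpow : ∀ (n : ℕ) (x : X), s x ((f ^ n) x) := by
    intro n
    induction n with
    | zero => intro x; exact s.refl x
    | succ n ih => intro x; rw [pow_succ']; exact s.trans (ih x) (h _)
  obtain ⟨i, rfl⟩ := hxy
  obtain ⟨n, rfl | rfl⟩ := i.eq_nat_or_neg
  · exact_mod_cast hpow n x
  · have := hpow n ((f ^ (-n : ℤ)) x)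
    rw [zpow_neg, zpow_natCast, ← Perm.mul_apply, mul_inv_cancel, Perm.one_apply] at this
    rw [zpow_neg, zpow_natCast]
    exact s.symm this

variable {n b : ℕ} {α : Perm ℕ}

lemma swap_mul_apply_fixed (hn : α n = n) : (swap b n * α) n = b := by
  simp [hn]

lemma swap_mul_apply_eq (z : ℕ) (hz : α z = b) : (swap b n * α) z = n := by
  simp [hz]

lemma swap_mul_apply_ne (z : ℕ) (hz : α z ≠ b) (hz' : α z ≠ n) :
    (swap b n * α) z = α z := by
  simp [swap_apply_of_ne_of_ne hz hz']

lemma sameCycle_swap_mul_of_sameCycle (hn : α n = n) {x y : ℕ} (h : α.SameCycle x y) :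
    (swap b n * α).SameCycle x y := by
  refine sameCycle_imp_of_forall_apply (s := Perm.SameCycle.setoid (swap b n * α)) ?_ h
  intro z
  change (swap b n * α).SameCycle z (α z)
  by_cases hz : α z = b
  · have h1 : (swap b n * α).SameCycle z ((swap b n * α) z) :=
      Perm.sameCycle_apply_right.2 (.refl _ _)
    have h2 : (swap b n * α).SameCycle n ((swap b n * α) n) :=
      Perm.sameCycle_apply_right.2 (.refl _ _)
    rw [swap_mul_apply_eq z hz] at h1
    rw [swap_mul_apply_fixed hn] at h2
    rw [hz]
    exact h1.trans h2
  · by_cases hz' : α z = n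
    · have : z = n := α.injective (hz'.trans hn.symm)
      rw [this, hn]
    · rw [← swap_mul_apply_ne z hz hz']
      simp [-Perm.coe_mul, Perm.SameCycle.rfl]

lemma sameCycle_of_sameCycle_swap_mul (hn : α n = n) {x y : ℕ}
    (h : (swap b n * α).SameCycle x y) :
    α.SameCycle (if x = n then b else x) (if y = n then b else y) := by
  refine sameCycle_imp_of_forall_apply
    (s := (Perm.SameCycle.setoid α).comap fun x => if x = n then b else x) ?_ h
  intro z
  change α.SameCycle (if z = n then b else z)
    (if (swap b n * α) z = n then b else (swap b n * α) z)
  by_cases hz : z = n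
  · rw [hz, swap_mul_apply_fixed hn]
    simp [Perm.SameCycle.rfl]
  · have hz' : α z ≠ n := fun h => hz (α.injective (h.trans hn.symm))
    by_cases hb : α z = b
    · rw [swap_mul_apply_eq z hb, if_neg hz, if_pos rfl, ← hb]
      simp [Perm.SameCycle.rfl]
    · rw [swap_mul_apply_ne z hb hz', if_neg hz, if_neg hz']
      simp [Perm.SameCycle.rfl]

lemma sameCycle_swap_mul_iff (hn : α n = n) {x y : ℕ} (hx : x ≠ n) (hy : y ≠ n) :
    (swap b n * α).SameCycle x y ↔ α.SameCycle x y :=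
  ⟨fun h => by simpa [hx, hy] using sameCycle_of_sameCycle_swap_mul hn h,
    sameCycle_swap_mul_of_sameCycle hn⟩

lemma sameCycle_swap_mul_left (hn : α n = n) : (swap b n * α).SameCycle n b := by
  have h := swap_mul_apply_fixed (b := b) hn
  nth_rw 2 [← h]
  simp [-Perm.coe_mul, Perm.SameCycle.rfl]

lemma eq_of_sameCycle_of_fixed {x y : ℕ} (h : α.SameCycle x y) (hx : α x = x) : y = x := by
  obtain ⟨i, rfl⟩ := h
  exact Perm.zpow_apply_eq_self_of_apply_eq_self hx i

lemma cycleMins_swap_mul (hα : ∀ i, n ≤ i → α i = i) (hb : b < n) :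
    cycleMins (n + 1) (swap b n * α) = cycleMins n α := by
  have hn := hα n le_rfl
  ext i
  simp only [mem_cycleMins]
  constructor
  · rintro ⟨h1, h2⟩
    have hin : i ≠ n := by
      rintro rfl
      have := h2 b (sameCycle_swap_mul_left hn)
      omega
    exact ⟨by omega, fun j hj => h2 j (sameCycle_swap_mul_of_sameCycle hn hj)⟩
  · rintro ⟨h1, h2⟩
    refine ⟨by omega, fun j hj => ?_⟩
    by_cases hjn : j = n
    · omega
    · exact h2 j ((sameCycle_swap_mul_iff hn (by omega) hjn).1 hj)

lemma cycleMins_succ (hα : ∀ i, n ≤ i → α i = i) :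
    cycleMins (n + 1) α = insert n (cycleMins n α) := by
  ext i
  simp only [mem_cycleMins, Finset.mem_insert]
  constructor
  · rintro ⟨h1, h2⟩
    by_cases h : i = n
    · exact .inl h
    · exact .inr ⟨by omega, h2⟩
  · rintro (rfl | ⟨h1, h2⟩)
    · exact ⟨by omega, fun j hj => (eq_of_sameCycle_of_fixed hj (hα _ le_rfl)).ge⟩
    · exact ⟨by omega, h2⟩

lemma fixed_swap_mul (hα : ∀ i, n ≤ i → α i = i) (hb : b ≤ n) (i : ℕ) (hi : n + 1 ≤ i) :
    (swap b n * α) i = i := by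
  rw [Perm.mul_apply, hα i (by omega), swap_apply_of_ne_of_ne] <;> omega

lemma noBackPoint_swap_mul_iff (hα : ∀ i, n ≤ i → α i = i) (hb : b ≤ n) :
    NoBackPoint (swap b n * α) ↔ NoBackPoint α ∧ b ∈ insert n (cycleMins n α) := by
  have hn := hα n le_rfl
  constructor
  · intro h
    have hmin : b = n ∨ (b < n ∧ ∀ j, α.SameCycle b j → b ≤ j) := by
      by_contra! hcon
      have hbn : b < n := by omega
      obtain ⟨j, hj, hjb⟩ := hcon.2 hbn
      refine h n ⟨by rwa [swap_mul_apply_fixed hn], j, ?_, by rwa [swap_mul_apply_fixed hn]⟩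
      exact (sameCycle_swap_mul_left hn).trans (sameCycle_swap_mul_of_sameCycle hn hj)
    refine ⟨fun i ⟨hi, j, hj, hji⟩ => ?_, ?_⟩
    · by_cases hb' : α i = b
      · have hbn : b ≠ n := by
          rintro rfl
          have : i = b := α.injective (hb'.trans hn.symm)
          omega
        have := (hmin.resolve_left hbn).2 j (by
          rw [← hb']; exact (Perm.sameCycle_apply_left).2 hj)
        omega
      · have hin : α i ≠ n := fun h' => by
          have : i = n := α.injective (h'.trans hn.symm)
          omega
        refine h i ⟨by rwa [swap_mul_apply_ne i hb' hin], j,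
          sameCycle_swap_mul_of_sameCycle hn hj, by rwa [swap_mul_apply_ne i hb' hin]⟩
    · rw [Finset.mem_insert, mem_cycleMins]
      exact hmin
  · rintro ⟨h, hmin⟩ i ⟨hi, j, hj, hji⟩
    rw [Finset.mem_insert, mem_cycleMins] at hmin
    by_cases hin : i = n
    · subst hin
      rw [swap_mul_apply_fixed hn] at hi hji
      have hj' := sameCycle_of_sameCycle_swap_mul hn hj
      rw [if_pos rfl, if_neg (by omega)] at hj'
      have := (hmin.resolve_left (by omega)).2 j hj'
      omega
    · have hin' : α i ≠ n := fun h' => hin (α.injective (h'.trans hn.symm))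
      by_cases hb' : α i = b
      · rw [swap_mul_apply_eq i hb'] at hi hji
        have : α i = i := hα i hi.le
        omega
      · rw [swap_mul_apply_ne i hb' hin'] at hi hji
        have hjn : j ≠ n := by
          rintro rfl
          have := hα i (by omega)
          omega
        exact h i ⟨hi, j, (sameCycle_swap_mul_iff hn hin hjn).1 hj, hji⟩

open Classical in
/-- The permutations of `ℕ` supported on `{0, …, n - 1}` that represent set partitions,
constructed by inserting the points one after the other. -/
noncomputable def partitionPerms : ℕ → Finset (Perm ℕ)
  | 0 => {1}
  | n + 1 => (partitionPerms n).biUnion fun α =>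
      (insert n (cycleMins n α)).image fun b => swap b n * α

lemma le_of_mem_insert_cycleMins (hb : b ∈ insert n (cycleMins n α)) : b ≤ n := by
  rw [Finset.mem_insert, mem_cycleMins] at hb
  omega

lemma mem_partitionPerms :
    α ∈ partitionPerms n ↔ (∀ i, n ≤ i → α i = i) ∧ NoBackPoint α := by
  induction n generalizing α with
  | zero =>
    simp only [partitionPerms, Finset.mem_singleton]
    constructor
    · rintro rfl
      exact ⟨fun _ _ => rfl, fun i h => by simp at h⟩
    · rintro ⟨h, -⟩
      ext i
      exact h i (Nat.zero_le i)
  | succ n ih =>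
    simp only [partitionPerms, Finset.mem_biUnion, Finset.mem_image]
    constructor
    · rintro ⟨γ, hγ, b, hb, rfl⟩
      obtain ⟨h1, h2⟩ := ih.1 hγ
      have hbn := le_of_mem_insert_cycleMins hb
      exact ⟨fixed_swap_mul h1 hbn, (noBackPoint_swap_mul_iff h1 hbn).2 ⟨h2, hb⟩⟩
    · rintro ⟨h1, h2⟩
      have hbn : α n ≤ n := by
        by_contra hlt
        have := α.injective (h1 (α n) (by omega))
        omega
      have heq : swap (α n) n * (swap (α n) n * α) = α := swap_mul_self_mul _ _ _
      have hfix : ∀ i, n ≤ i → (swap (α n) n * α) i = i := by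
        intro i hi
        rcases hi.eq_or_lt with rfl | hi
        · simp
        · rw [Perm.mul_apply, h1 i hi, swap_apply_of_ne_of_ne] <;> omega
      rw [← heq] at h2
      obtain ⟨h3, h4⟩ := (noBackPoint_swap_mul_iff hfix hbn).1 h2
      exact ⟨_, ih.2 ⟨hfix, h3⟩, _, h4, heq⟩

lemma sum_partitionPerms_succ (n : ℕ) (Φ : Perm ℕ → ℕ) :
    ∑ α ∈ partitionPerms (n + 1), Φ α =
      ∑ α ∈ partitionPerms n, ∑ b ∈ insert n (cycleMins n α), Φ (swap b n * α) := by
  classical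
  have key : ∀ α ∈ partitionPerms n, ∀ γ ∈ partitionPerms n, ∀ b c : ℕ,
      swap b n * α = swap c n * γ → b = c ∧ α = γ := by
    intro α hα γ hγ b c h
    have hα' := (mem_partitionPerms.1 hα).1 n le_rfl
    have hγ' := (mem_partitionPerms.1 hγ).1 n le_rfl
    have hbc : b = c := by
      rw [← swap_mul_apply_fixed (b := b) hα', h, swap_mul_apply_fixed hγ']
    subst hbc
    exact ⟨rfl, mul_left_cancel h⟩
  rw [partitionPerms, Finset.sum_biUnion]
  · refine Finset.sum_congr rfl fun α hα => ?_
    rw [Finset.sum_image]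
    intro b _ c _ h
    exact (key α hα α hα b c h).1
  · intro α hα γ hγ hne
    rw [Function.onFun, Finset.disjoint_left]
    rintro x hx hy
    simp only [Finset.mem_image] at hx hy
    obtain ⟨b, -, rfl⟩ := hx
    obtain ⟨c, -, hc⟩ := hy
    exact hne (key γ hγ α hα c b hc).2.symm

end Insertion

section Faces

/-- `IsRun β x l y`: iterating `β` from `x` runs through the list `l` and then reaches `y`. -/
def IsRun (β : ℕ → ℕ) : ℕ → List ℕ → ℕ → Prop
  | x, [], y => β x = y
  | x, a :: l, y => β x = a ∧ IsRun β a l y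

/-- The entries of `l` form a cycle of `β`, listed in the order in which `β` permutes them. -/
def IsCycleList (β : ℕ → ℕ) (l : List ℕ) : Prop :=
  ∃ x Z, l = Z ++ [x] ∧ IsRun β x Z x

lemma isRun_append_cons {β : ℕ → ℕ} {x p y : ℕ} {A B : List ℕ} :
    IsRun β x (A ++ p :: B) y ↔ IsRun β x A p ∧ IsRun β p B y := by
  induction A generalizing x with
  | nil => simp [IsRun]
  | cons a A ih => simp [IsRun, ih, and_assoc]

lemma IsRun.congr {β β' : ℕ → ℕ} {x x' y : ℕ} {l : List ℕ} (h : IsRun β x l y)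
    (hx : β' x' = β x) (hl : ∀ a ∈ l, β' a = β a) : IsRun β' x' l y := by
  induction l generalizing x x' with
  | nil => exact hx.trans h
  | cons a l ih =>
    exact ⟨hx.trans h.1, ih h.2 (hl a (by simp)) fun b hb => hl b (by simp [hb])⟩

lemma IsRun.apply_mem {β : ℕ → ℕ} {x y : ℕ} {l : List ℕ} (h : IsRun β x l y) {a : ℕ}
    (ha : a ∈ x :: l) : β a ∈ l ++ [y] := by
  induction l generalizing x with
  | nil => simp_all [IsRun]
  | cons b l ih =>
    rcases List.mem_cons.1 ha with rfl | ha
    · simp [h.1]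
    · exact List.mem_cons_of_mem _ (ih h.2 ha)

lemma IsRun.sameCycle {β : Equiv.Perm ℕ} {x y : ℕ} {l : List ℕ} (h : IsRun β x l y) {a : ℕ}
    (ha : a ∈ l ++ [y]) : β.SameCycle x a := by
  have hx : β.SameCycle x (β x) := Equiv.Perm.sameCycle_apply_right.2 (.refl _ _)
  induction l generalizing x with
  | nil =>
    have : a = β x := by simp_all [IsRun]
    rwa [this]
  | cons b l ih =>
    obtain ⟨rfl, h⟩ := h
    rcases List.mem_cons.1 ha with rfl | ha
    · exact hx
    · exact hx.trans (ih h ha (Equiv.Perm.sameCycle_apply_right.2 (.refl _ _)))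

lemma IsCycleList.apply_mem {β : ℕ → ℕ} {l : List ℕ} (h : IsCycleList β l) {a : ℕ}
    (ha : a ∈ l) : β a ∈ l := by
  obtain ⟨x, Z, rfl, hr⟩ := h
  exact hr.apply_mem (by simpa [or_comm] using ha)

lemma IsCycleList.sameCycle {β : Equiv.Perm ℕ} {l : List ℕ} (h : IsCycleList β l) {a b : ℕ}
    (ha : a ∈ l) (hb : b ∈ l) : β.SameCycle a b := by
  obtain ⟨x, Z, rfl, hr⟩ := h
  exact (hr.sameCycle ha).symm.trans (hr.sameCycle hb)

lemma IsCycleList.ne_nil {β : ℕ → ℕ} {l : List ℕ} (h : IsCycleList β l) : l ≠ [] := by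
  obtain ⟨x, Z, rfl, -⟩ := h
  simp

lemma IsCycleList.congr {β β' : ℕ → ℕ} {l : List ℕ} (h : IsCycleList β l)
    (hl : ∀ a ∈ l, β' a = β a) : IsCycleList β' l := by
  obtain ⟨x, Z, rfl, hr⟩ := h
  exact ⟨x, Z, rfl, hr.congr (hl x (by simp)) fun a ha => hl a (by simp [ha])⟩

lemma IsCycleList.exists_rotation {β : ℕ → ℕ} {l : List ℕ} (h : IsCycleList β l) {p : ℕ}
    (hp : p ∈ l) : ∃ Z, IsRun β p Z p ∧ (Z ++ [p]).Perm l := by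
  obtain ⟨x, Z, rfl, hr⟩ := h
  rcases List.mem_append.1 hp with hp | hp
  · obtain ⟨A, B, rfl⟩ := List.append_of_mem hp
    rw [isRun_append_cons] at hr
    refine ⟨B ++ x :: A, isRun_append_cons.2 ⟨hr.2, hr.1⟩, ?_⟩
    rw [List.perm_iff_count]
    intro a
    simp only [List.count_append, List.count_cons, List.count_nil]
    omega
  · obtain rfl : p = x := by simpa using hp
    exact ⟨Z, hr, .refl _⟩

/-- The cycles of `β` on `{0, …, n}` are `L ++ [n]` and the members of `Ls`. -/
structure FaceLists (n : ℕ) (β : ℕ → ℕ) (L : List ℕ) (Ls : List (List ℕ)) : Prop where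
  perm : (L ++ n :: Ls.flatten).Perm (List.range (n + 1))
  run : IsRun β n L n
  cycles : ∀ l ∈ Ls, IsCycleList β l

namespace FaceLists

variable {n : ℕ} {β β' : ℕ → ℕ} {L : List ℕ} {Ls : List (List ℕ)}

lemma nodup (h : FaceLists n β L Ls) : (L ++ n :: Ls.flatten).Nodup :=
  h.perm.nodup_iff.2 List.nodup_range

lemma lt_of_mem (h : FaceLists n β L Ls) {q : ℕ} (hq : q ∈ L) : q < n := by
  have h1 : q < n + 1 := List.mem_range.1 (h.perm.subset (by simp [hq]))
  have h2 : q ≠ n := by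
    rintro rfl
    have := h.nodup
    simp only [List.nodup_append] at this
    exact this.2.2 q hq q (by simp) rfl
  omega

lemma lt_of_mem_mem (h : FaceLists n β L Ls) {q : ℕ} {l : List ℕ} (hl : l ∈ Ls)
    (hq : q ∈ l) : q < n := by
  have h1 : q < n + 1 :=
    List.mem_range.1 (h.perm.subset (by simp; exact .inr (.inr ⟨l, hl, hq⟩)))
  have h2 : q ≠ n := by
    rintro rfl
    have := h.nodup
    simp only [List.nodup_append, List.nodup_cons, List.mem_flatten] at this
    exact this.2.1.1 ⟨l, hl, hq⟩
  omega

lemma notMem_of_mem (h : FaceLists n β L Ls) {q : ℕ} {l : List ℕ} (hl : l ∈ Ls)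
    (hq : q ∈ l) : q ∉ L := by
  intro hqL
  have := h.nodup
  rw [List.nodup_append] at this
  exact this.2.2 q hqL q (by simp; exact .inr ⟨l, hl, hq⟩) rfl

lemma perm_left (h : FaceLists n β L Ls) {Ls' : List (List ℕ)} (hp : Ls.Perm Ls') :
    FaceLists n β L Ls' :=
  ⟨(List.Perm.append_left _ (hp.flatten.cons _)).symm.trans h.perm, h.run,
    fun l hl => h.cycles l (hp.mem_iff.2 hl)⟩

lemma extend_top (h : FaceLists n β L Ls) (h1 : β' n = n + 1) (h2 : β' (n + 1) = β n)
    (h3 : ∀ q < n, β' q = β q) : FaceLists (n + 1) β' (L ++ [n]) Ls := by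
  refine ⟨?_, ?_, fun l hl => (h.cycles l hl).congr fun a ha => h3 a (h.lt_of_mem_mem hl ha)⟩
  · rw [List.range_succ, List.perm_iff_count]
    intro a
    have := h.perm.count_eq a
    simp only [List.count_append, List.count_cons, List.count_nil] at this ⊢
    omega
  · exact isRun_append_cons.2 ⟨h.run.congr h2 fun a ha => h3 a (h.lt_of_mem ha), h1⟩

lemma extend_zero (h : FaceLists n β L Ls) (h1 : β' n = β n) (h2 : β' (n + 1) = n + 1)
    (h3 : ∀ q < n, β' q = β q) : FaceLists (n + 1) β' [] ((L ++ [n]) :: Ls) := by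
  refine ⟨?_, h2, ?_⟩
  · rw [List.range_succ, List.perm_iff_count]
    intro a
    have := h.perm.count_eq a
    simp only [List.count_append, List.count_cons, List.count_nil, List.flatten_cons] at this ⊢
    omega
  · rintro l (_ | ⟨_, hl⟩)
    · exact ⟨n, L, rfl, h.run.congr h1 fun a ha => h3 a (h.lt_of_mem ha)⟩
    · exact (h.cycles l hl).congr fun a ha => h3 a (h.lt_of_mem_mem hl ha)

lemma extend_split {A B : List ℕ} {p : ℕ} (h : FaceLists n β (A ++ p :: B) Ls)
    (h1 : β' n = β p) (h2 : β' (n + 1) = β n) (h3 : β' p = n + 1)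
    (h4 : ∀ q < n, q ≠ p → β' q = β q) :
    FaceLists (n + 1) β' (A ++ [p]) ((B ++ [n]) :: Ls) := by
  have hnd := h.nodup
  have hrun := isRun_append_cons.1 h.run
  refine ⟨?_, ?_, ?_⟩
  · rw [List.range_succ, List.perm_iff_count]
    intro a
    have := h.perm.count_eq a
    simp only [List.count_append, List.count_cons, List.count_nil, List.flatten_cons] at this ⊢
    omega
  · refine isRun_append_cons.2 ⟨hrun.1.congr h2 fun a ha => ?_, h3⟩
    refine h4 a (h.lt_of_mem (by simp [ha])) ?_
    rintro rfl
    rw [List.nodup_append] at hnd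
    rw [List.nodup_append] at hnd
    exact hnd.1.2.2 a ha a (by simp) rfl
  · rintro l (_ | ⟨_, hl⟩)
    · refine ⟨n, B, rfl, hrun.2.congr h1 fun a ha => ?_⟩
      refine h4 a (h.lt_of_mem (by simp [ha])) ?_
      rintro rfl
      simp [List.nodup_append, ha] at hnd
    · refine (h.cycles l hl).congr fun a ha => h4 a (h.lt_of_mem_mem hl ha) ?_
      rintro rfl
      exact h.notMem_of_mem hl ha (by simp)

lemma extend_merge {l Z : List ℕ} {p : ℕ} (h : FaceLists n β L (l :: Ls))
    (hZ : IsRun β p Z p) (hl : (Z ++ [p]).Perm l)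
    (h1 : β' n = β p) (h2 : β' (n + 1) = β n) (h3 : β' p = n + 1)
    (h4 : ∀ q < n, q ≠ p → β' q = β q) :
    FaceLists (n + 1) β' (L ++ n :: (Z ++ [p])) Ls := by
  have hnd := h.nodup
  have hpl : p ∈ l := hl.subset (by simp)
  refine ⟨?_, ?_, ?_⟩
  · rw [List.range_succ, List.perm_iff_count]
    intro a
    have := h.perm.count_eq a
    have hla := hl.count_eq a
    simp only [List.count_append, List.count_cons, List.count_nil, List.flatten_cons]
      at this hla ⊢
    omega
  · refine isRun_append_cons.2 ⟨h.run.congr h2 fun a ha => h4 a (h.lt_of_mem ha) ?_,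
      isRun_append_cons.2 ⟨hZ.congr h1 fun a ha => ?_, h3⟩⟩
    · rintro rfl
      exact h.notMem_of_mem (by simp) hpl ha
    · refine h4 a (h.lt_of_mem_mem (l := l) (by simp) (hl.subset (by simp [ha]))) ?_
      rintro rfl
      simp only [List.flatten_cons, List.nodup_append, List.nodup_cons] at hnd
      have := hl.nodup_iff.2 hnd.2.1.2.1
      rw [List.nodup_append] at this
      exact this.2.2 a ha a (by simp) rfl
  · intro l' hl'
    refine (h.cycles l' (by simp [hl'])).congr fun a ha =>
      h4 a (h.lt_of_mem_mem (l := l') (by simp [hl']) ha) ?_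
    rintro rfl
    simp only [List.flatten_cons, List.nodup_append, List.nodup_cons] at hnd
    exact hnd.2.1.2.2.2 a hpl a (List.mem_flatten.2 ⟨l', hl', ha⟩) rfl

end FaceLists

end Faces

section States

open Equiv

/-- The cycle `(0, 1, …, n - 1)` as a permutation of `ℕ`. -/
def natRotate : ℕ → Perm ℕ
  | 0 => 1
  | n + 1 => swap 0 n * natRotate n

lemma natRotate_apply (n i : ℕ) :
    natRotate n i = if i + 1 < n then i + 1 else if i + 1 = n then 0 else i := by
  induction n with
  | zero => simp [natRotate]
  | succ n ih =>
    rw [natRotate, Perm.mul_apply, ih]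
    rcases lt_trichotomy (i + 1) n with h | h | h
    · rw [if_pos h, swap_apply_of_ne_of_ne (by omega) (by omega), if_pos (by omega)]
    · rw [if_neg (by omega), if_pos h, swap_apply_left, if_pos (by omega), h]
    · rw [if_neg (by omega), if_neg (by omega)]
      by_cases hi : i = n
      · rw [hi, swap_apply_right, if_neg (by omega), if_pos rfl]
      · rw [swap_apply_of_ne_of_ne (by omega) hi, if_neg (by omega), if_neg (by omega)]

/-- The permutation whose cycles are the faces of `α`, seen as a partition of
`{0, …, n - 1}`. -/
def facePerm (n : ℕ) (α : Perm ℕ) : Perm ℕ := α⁻¹ * natRotate n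

section

variable {n b : ℕ} {α : Perm ℕ}

lemma facePerm_swap_mul_apply (q : ℕ) : facePerm (n + 2) (swap b (n + 1) * α) q =
    α⁻¹ (swap b (n + 1) (natRotate (n + 2) q)) := by
  rw [facePerm, mul_inv_rev, swap_inv]
  rfl

lemma facePerm_swap_mul_of_lt {q : ℕ} (hq : q < n) (hqb : q + 1 ≠ b) :
    facePerm (n + 2) (swap b (n + 1) * α) q = facePerm (n + 1) α q := by
  rw [facePerm_swap_mul_apply, facePerm, Perm.mul_apply, natRotate_apply, natRotate_apply,
    if_pos (by omega), if_pos (by omega), swap_apply_of_ne_of_ne hqb (by omega)]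

lemma inv_apply_of_fixed (hα : ∀ i, n + 1 ≤ i → α i = i) : α⁻¹ (n + 1) = n + 1 := by
  rw [Perm.inv_eq_iff_eq, hα _ le_rfl]

lemma facePerm_apply_last : facePerm (n + 1) α n = α⁻¹ 0 := by
  simp [facePerm, natRotate_apply]

lemma facePerm_swap_mul_last (hb : b ≠ 0) :
    facePerm (n + 2) (swap b (n + 1) * α) (n + 1) = facePerm (n + 1) α n := by
  rw [facePerm_swap_mul_apply, facePerm_apply_last, natRotate_apply, if_neg (by omega),
    if_pos rfl, swap_apply_of_ne_of_ne hb.symm (by omega)]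

lemma facePerm_swap_zero_mul_last (hα : ∀ i, n + 1 ≤ i → α i = i) :
    facePerm (n + 2) (swap 0 (n + 1) * α) (n + 1) = n + 1 := by
  rw [facePerm_swap_mul_apply, natRotate_apply, if_neg (by omega),
    if_pos rfl, swap_apply_left, inv_apply_of_fixed hα]

lemma facePerm_swap_mul_pred_last : facePerm (n + 2) (swap b (n + 1) * α) n = α⁻¹ b := by
  rw [facePerm_swap_mul_apply, natRotate_apply, if_pos (by omega), swap_apply_right]

lemma facePerm_apply_of_lt {p : ℕ} (hp : p < n) :
    facePerm (n + 1) α p = α⁻¹ (p + 1) := by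
  simp [facePerm, natRotate_apply, hp]

lemma facePerm_swap_mul_pred (hα : ∀ i, n + 1 ≤ i → α i = i) {p : ℕ} (hp : p < n) :
    facePerm (n + 2) (swap (p + 1) (n + 1) * α) p = n + 1 := by
  rw [facePerm_swap_mul_apply, natRotate_apply, if_pos (by omega), swap_apply_left,
    inv_apply_of_fixed hα]

end

/-- The number of entries `p` of `l` for which `p + 1` belongs to `M`. -/
def blockCount (M : Finset ℕ) (l : List ℕ) : ℕ := l.countP fun p => decide (p + 1 ∈ M)

lemma blockCount_append (M : Finset ℕ) (l l' : List ℕ) :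
    blockCount M (l ++ l') = blockCount M l + blockCount M l' := by
  simp [blockCount]

lemma blockCount_cons_of_mem {M : Finset ℕ} {p : ℕ} (hp : p + 1 ∈ M) (l : List ℕ) :
    blockCount M (p :: l) = blockCount M l + 1 := by
  simp [blockCount, hp]

lemma blockCount_cons_of_notMem {M : Finset ℕ} {p : ℕ} (hp : p + 1 ∉ M) (l : List ℕ) :
    blockCount M (p :: l) = blockCount M l := by
  simp [blockCount, hp]

lemma blockCount_nil (M : Finset ℕ) : blockCount M [] = 0 := rfl

lemma blockCount_insert {M : Finset ℕ} {n : ℕ} {l : List ℕ} (hl : n ∉ l) :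
    blockCount (insert (n + 1) M) l = blockCount M l := by
  unfold blockCount
  refine List.countP_congr fun p hp => ?_
  have : p ≠ n := fun h => hl (h ▸ hp)
  simp [this]

/-- `α` is supported on `{0, …, n}`; its face through `n` contains the predecessors of `i` block
minima other than `0`, and `m` lists the number of predecessors of block minima in the
other faces. -/
def HasState (n : ℕ) (α : Perm ℕ) (i : ℕ) (m : List ℕ) : Prop :=
  (∀ j, n + 1 ≤ j → α j = j) ∧ ∃ L Ls, FaceLists n (facePerm (n + 1) α) L Ls ∧
    blockCount (cycleMins (n + 1) α) L = i ∧ Ls.map (blockCount (cycleMins (n + 1) α)) = m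

lemma sum_map_eq_sum_range_blockCount {M : Finset ℕ} {L : List ℕ} {g f : ℕ → ℕ}
    (h0 : ∀ p ∈ L, p + 1 ∉ M → g p = 0)
    (h1 : ∀ A p B, L = A ++ p :: B → p + 1 ∈ M → g p = f (blockCount M A)) :
    (L.map g).sum = ∑ j ∈ Finset.range (blockCount M L), f j := by
  induction L generalizing f with
  | nil => simp [blockCount]
  | cons a L ih =>
    by_cases ha : a + 1 ∈ M
    · rw [blockCount_cons_of_mem ha, Finset.sum_range_succ', List.map_cons, List.sum_cons,
        ih (f := fun j => f (j + 1)) (fun p hp => h0 p (by simp [hp])) ?_,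
        h1 [] a L rfl ha, blockCount_nil, add_comm]
      intro A p B hL hp
      rw [h1 (a :: A) p B (by simp [hL]) hp, blockCount_cons_of_mem ha]
    · rw [blockCount_cons_of_notMem ha, List.map_cons, List.sum_cons,
        ih (f := f) (fun p hp => h0 p (by simp [hp])) ?_, h0 a (by simp) ha, zero_add]
      intro A p B hL hp
      rw [h1 (a :: A) p B (by simp [hL]) hp, blockCount_cons_of_notMem ha]

lemma sum_map_eq_blockCount_mul {M : Finset ℕ} {l : List ℕ} {g : ℕ → ℕ} {c : ℕ}
    (h0 : ∀ p ∈ l, p + 1 ∉ M → g p = 0) (h1 : ∀ p ∈ l, p + 1 ∈ M → g p = c) :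
    (l.map g).sum = blockCount M l * c := by
  rw [sum_map_eq_sum_range_blockCount (M := M) (f := fun _ => c) h0]
  · simp
  · rintro A p B rfl hp
    exact h1 p (by simp) hp

lemma sum_cycleMins {n : ℕ} {β : ℕ → ℕ} {L : List ℕ} {Ls : List (List ℕ)} {M : Finset ℕ}
    (h : FaceLists n β L Ls) (h0 : 0 ∈ M) (hM : ∀ b ∈ M, b < n + 1) (G : ℕ → ℕ) :
    ∑ b ∈ M, G b = G 0 + (L.map fun p => if p + 1 ∈ M then G (p + 1) else 0).sum +
      (Ls.map fun l => (l.map fun p => if p + 1 ∈ M then G (p + 1) else 0).sum).sum := by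
  set g : ℕ → ℕ := fun p => if p + 1 ∈ M then G (p + 1) else 0 with hg
  have h1 : ∑ b ∈ M, G b = ∑ b ∈ Finset.range (n + 1 + 1), if b ∈ M then G b else 0 := by
    rw [← Finset.sum_filter]
    refine Finset.sum_congr ?_ fun _ _ => rfl
    ext b
    have := hM b
    simp only [Finset.mem_filter, Finset.mem_range]
    grind
  have h2 : ∑ p ∈ Finset.range (n + 1), g p = ((List.range (n + 1)).map g).sum := rfl
  have hn : n + 1 ∉ M := fun hn => lt_irrefl _ (hM _ hn)
  rw [h1, Finset.sum_range_succ', if_pos h0]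
  change ∑ p ∈ Finset.range (n + 1), g p + G 0 = _
  rw [h2, ← (h.perm.map g).sum_eq]
  simp only [List.map_append, List.map_cons, List.sum_append, List.sum_cons, List.map_flatten,
    List.sum_flatten, List.map_map]
  have : g n = 0 := if_neg hn
  rw [this]
  simp only [Function.comp_def]
  omega

lemma zero_mem_cycleMins (n : ℕ) (α : Perm ℕ) : 0 ∈ cycleMins (n + 1) α := by
  simp [mem_cycleMins]

lemma lt_of_mem_cycleMins {n : ℕ} {α : Perm ℕ} {b : ℕ} (h : b ∈ cycleMins n α) : b < n :=
  (mem_cycleMins.1 h).1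

lemma sum_insert_of_hasState {n i : ℕ} {α : Perm ℕ} {m : List ℕ} (hs : HasState n α i m)
    {Φ : Perm ℕ → ℕ} {f h : ℕ → ℕ}
    (h1 : ∀ γ, HasState (n + 1) γ (i + 1) m → Φ γ = f (i + 1))
    (h2 : ∀ γ j, j ≤ i → HasState (n + 1) γ j ((i - j) :: m) → Φ γ = f j)
    (h3 : ∀ γ c m', c ∈ m → m'.sum + m'.length + c + 1 = m.sum + m.length →
      HasState (n + 1) γ (i + c) m' → Φ γ = h c) :
    ∑ b ∈ insert (n + 1) (cycleMins (n + 1) α), Φ (swap b (n + 1) * α) =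
      ∑ j ∈ Finset.range (i + 2), f j + (m.map fun c => c * h c).sum := by
  obtain ⟨hfix, L, Ls, hF, rfl, rfl⟩ := hs
  set M := cycleMins (n + 1) α with hM
  have hn1 : n + 1 ∉ M := fun h => lt_irrefl _ (lt_of_mem_cycleMins h)
  have hnL : n ∉ L := fun h => lt_irrefl _ (hF.lt_of_mem h)
  have hnLs : ∀ l ∈ Ls, n ∉ l := fun l hl h => lt_irrefl _ (hF.lt_of_mem_mem hl h)
  have htop : Φ (swap (n + 1) (n + 1) * α) = f (blockCount M L + 1) := by
    apply h1
    refine ⟨fixed_swap_mul hfix le_rfl, L ++ [n], Ls, hF.extend_top ?_ ?_ ?_, ?_, ?_⟩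
    · rw [facePerm_swap_mul_pred_last, inv_apply_of_fixed hfix]
    · exact facePerm_swap_mul_last (by omega)
    · exact fun q hq => facePerm_swap_mul_of_lt hq (by omega)
    · rw [swap_self, ← Perm.one_def, one_mul, cycleMins_succ hfix, ← hM, blockCount_append,
        blockCount_insert hnL, blockCount_cons_of_mem (by simp), blockCount_nil]
    · rw [swap_self, ← Perm.one_def, one_mul, cycleMins_succ hfix, ← hM]
      exact List.map_congr_left fun l hl => blockCount_insert (hnLs l hl)
  have hmins : ∀ b < n + 1, cycleMins (n + 2) (swap b (n + 1) * α) = M :=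
    fun b hb => cycleMins_swap_mul hfix hb
  have hzero : Φ (swap 0 (n + 1) * α) = f 0 := by
    apply h2 _ 0 (Nat.zero_le _)
    refine ⟨fixed_swap_mul hfix (Nat.zero_le _), [], _, hF.extend_zero ?_ ?_ ?_, ?_, ?_⟩
    · rw [facePerm_swap_mul_pred_last, facePerm_apply_last]
    · exact facePerm_swap_zero_mul_last hfix
    · exact fun q hq => facePerm_swap_mul_of_lt hq (by omega)
    · rfl
    · rw [hmins 0 (by omega), List.map_cons, blockCount_append, blockCount_cons_of_notMem hn1]
      rfl
  have hL : (L.map fun p => if p + 1 ∈ M then Φ (swap (p + 1) (n + 1) * α) else 0).sum =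
      ∑ j ∈ Finset.range (blockCount M L), f (j + 1) := by
    apply sum_map_eq_sum_range_blockCount
    · intro p _ hp
      exact if_neg hp
    · rintro A p B rfl hp
      have hpn : p < n := hF.lt_of_mem (by simp)
      rw [if_pos hp]
      apply h2
      · rw [blockCount_append, blockCount_cons_of_mem hp]
        omega
      · refine ⟨fixed_swap_mul hfix (by omega), _, _, hF.extend_split ?_ ?_ ?_ ?_, ?_, ?_⟩
        · rw [facePerm_swap_mul_pred_last, facePerm_apply_of_lt hpn]
        · exact facePerm_swap_mul_last (by omega)
        · exact facePerm_swap_mul_pred hfix hpn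
        · exact fun q hq hqp => facePerm_swap_mul_of_lt hq (by omega)
        · rw [hmins _ (by omega), blockCount_append, blockCount_cons_of_mem hp, blockCount_nil]
        · rw [hmins _ (by omega), List.map_cons, blockCount_append, blockCount_append,
            blockCount_cons_of_mem hp, blockCount_cons_of_notMem hn1, blockCount_nil]
          congr 1
          omega
  have hLs : (Ls.map fun l => (l.map fun p =>
      if p + 1 ∈ M then Φ (swap (p + 1) (n + 1) * α) else 0).sum).sum =
        ((Ls.map (blockCount M)).map fun c => c * h c).sum := by
    rw [List.map_map]
    congr 1
    refine List.map_congr_left fun l hl => ?_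
    apply sum_map_eq_blockCount_mul
    · intro p _ hp
      exact if_neg hp
    · intro p hpl hp
      have hpn : p < n := hF.lt_of_mem_mem hl hpl
      have hperm := List.perm_cons_erase hl
      have hF' := hF.perm_left hperm
      obtain ⟨Z, hZ, hZl⟩ := (hF.cycles l hl).exists_rotation hpl
      have hcount : blockCount M Z + 1 = blockCount M l := by
        have := hZl.countP_eq fun p => decide (p + 1 ∈ M)
        change blockCount M (Z ++ [p]) = blockCount M l at this
        rw [← this, blockCount_append, blockCount_cons_of_mem hp, blockCount_nil]
      rw [if_pos hp]
      refine h3 _ _ ((Ls.erase l).map (blockCount M)) (List.mem_map.2 ⟨l, hl, rfl⟩) ?_ ?_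
      · rw [(hperm.map (blockCount M)).sum_eq, (hperm.map (blockCount M)).length_eq]
        simp only [List.map_cons, List.sum_cons, List.length_cons]
        omega
      · refine ⟨fixed_swap_mul hfix (by omega), _, _,
          hF'.extend_merge hZ hZl ?_ ?_ ?_ ?_, ?_, ?_⟩
        · rw [facePerm_swap_mul_pred_last, facePerm_apply_of_lt hpn]
        · exact facePerm_swap_mul_last (by omega)
        · exact facePerm_swap_mul_pred hfix hpn
        · exact fun q hq hqp => facePerm_swap_mul_of_lt hq (by omega)
        · rw [hmins _ (by omega), blockCount_append, blockCount_cons_of_notMem hn1,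
            blockCount_append, blockCount_cons_of_mem hp, blockCount_nil, ← hcount]
        · rw [hmins _ (by omega)]
  rw [Finset.sum_insert hn1, sum_cycleMins hF (zero_mem_cycleMins n α)
    (fun b hb => lt_of_mem_cycleMins hb), htop, hzero, hL, hLs, Finset.sum_range_succ,
    Finset.sum_range_succ']
  omega

end States

section Genus

open Equiv

/-- A permutation of `Fin N`, extended to `ℕ` by fixing all `i ≥ N`. -/
def natExtend {N : ℕ} (γ : Perm (Fin N)) : Perm ℕ := γ.extendDomain Fin.equivSubtype

variable {N : ℕ}

lemma natExtend_apply (γ : Perm (Fin N)) (a : Fin N) : natExtend γ a = γ a :=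
  γ.extendDomain_apply_image Fin.equivSubtype a

lemma natExtend_apply_of_le (γ : Perm (Fin N)) {i : ℕ} (hi : N ≤ i) : natExtend γ i = i :=
  γ.extendDomain_apply_not_subtype Fin.equivSubtype (not_lt.2 hi)

lemma natExtend_injective : Function.Injective (natExtend (N := N)) :=
  Perm.extendDomainHom_injective Fin.equivSubtype

lemma sameCycle_natExtend {γ : Perm (Fin N)} {a b : Fin N} :
    (natExtend γ).SameCycle a b ↔ γ.SameCycle a b :=
  Perm.sameCycle_extendDomain (f := Fin.equivSubtype)

lemma exists_natExtend_eq {α : Perm ℕ} (hα : ∀ i, N ≤ i → α i = i) :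
    ∃ γ : Perm (Fin N), natExtend γ = α := by
  have hlt : ∀ i, i < N ↔ α i < N := by
    intro i
    by_cases hi : N ≤ i
    · rw [hα i hi]
    · refine iff_of_true (not_le.1 hi) (not_le.1 fun h => hi ?_)
      rwa [α.injective (hα _ h)] at h
  refine ⟨Fin.equivSubtype.symm.permCongr (α.subtypePerm fun i => (hlt i).symm), ?_⟩
  ext i
  by_cases hi : N ≤ i
  · rw [natExtend_apply_of_le _ hi, hα i hi]
  · lift i to Fin N using not_le.1 hi
    rw [natExtend_apply]
    rfl

lemma natExtend_finRotate : natExtend (finRotate N) = natRotate N := by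
  ext i
  rw [natRotate_apply]
  by_cases hi : N ≤ i
  · rw [natExtend_apply_of_le _ hi, if_neg (by omega), if_neg (by omega)]
  · lift i to Fin N using not_le.1 hi
    rw [natExtend_apply]
    obtain _ | N := N
    · exact i.elim0
    · rw [coe_finRotate]
      have := i.is_lt
      split_ifs <;> simp_all [Fin.ext_iff]; omega

lemma facePerm_natExtend (γ : Perm (Fin N)) :
    facePerm N (natExtend γ) = natExtend (γ⁻¹ * finRotate N) := by
  rw [facePerm, ← natExtend_finRotate]
  exact Perm.extendDomain_mul Fin.equivSubtype γ⁻¹ (finRotate N)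

lemma noBackPoint_natExtend_iff (γ : Perm (Fin N)) :
    NoBackPoint (natExtend γ) ↔ IsPartitionPerm γ := by
  constructor
  · rintro h i ⟨h1, j, h2, h3⟩
    refine h i ⟨by rw [natExtend_apply]; exact h1, j, sameCycle_natExtend.2 h2, ?_⟩
    rw [natExtend_apply]
    exact h3
  · rintro h i ⟨h1, j, h2, h3⟩
    by_cases hi : N ≤ i
    · rw [natExtend_apply_of_le _ hi] at h1
      exact lt_irrefl _ h1
    · lift i to Fin N using not_le.1 hi
      rw [natExtend_apply] at h1 h3
      lift j to Fin N using h3.trans (γ i).is_lt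
      exact h i ⟨h1, j, sameCycle_natExtend.1 h2, h3⟩

lemma zPerm_eq_card_cycleMins (γ : Perm (Fin N)) :
    zPerm γ = (cycleMins N (natExtend γ)).card := by
  have hlt : ∀ b : cycleMins N (natExtend γ), (b : ℕ) < N := fun b => lt_of_mem_cycleMins b.2
  let φ : cycleMins N (natExtend γ) → Quotient (cycleSetoid γ) := fun b =>
    Quotient.mk _ ⟨b, hlt b⟩
  have hφ : Function.Bijective φ := by
    constructor
    · intro b c hbc
      have h : γ.SameCycle ⟨b, hlt b⟩ ⟨c, hlt c⟩ := Quotient.exact hbc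
      have h' := sameCycle_natExtend.2 h
      exact Subtype.ext (le_antisymm ((mem_cycleMins.1 b.2).2 _ h')
        ((mem_cycleMins.1 c.2).2 _ h'.symm))
    · intro q
      induction q using Quotient.inductionOn with
      | h x =>
        classical
        have hne : ∃ k, (natExtend γ).SameCycle x k := ⟨x, .refl _ _⟩
        have hk := Nat.find_spec hne
        have hle : Nat.find hne ≤ x := Nat.find_min' hne (.refl _ _)
        refine ⟨⟨Nat.find hne, mem_cycleMins.2 ⟨hle.trans_lt x.is_lt, fun j hj =>
          Nat.find_min' hne (hk.trans hj)⟩⟩, Quotient.sound ?_⟩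
        exact sameCycle_natExtend.1 hk.symm
  rw [zPerm, ← Nat.card_congr (Equiv.ofBijective φ hφ), Nat.card_eq_fintype_card,
    Fintype.card_coe]

lemma zPerm_eq_length {γ : Perm (Fin N)} {K : List (List ℕ)}
    (hp : K.flatten.Perm (List.range N)) (hc : ∀ l ∈ K, IsCycleList (natExtend γ) l) :
    zPerm γ = K.length := by
  have hnd : K.flatten.Nodup := hp.nodup_iff.2 List.nodup_range
  have hdisj := (List.nodup_flatten.1 hnd).2
  have hcl : ∀ k : Fin K.length, IsCycleList (natExtend γ) K[k] := fun k =>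
    hc _ (List.getElem_mem _)
  have hmem : ∀ k : Fin K.length, ∃ x : Fin N, (x : ℕ) ∈ K[k] := by
    intro k
    obtain ⟨x, hx⟩ := List.exists_mem_of_ne_nil _ (hcl k).ne_nil
    have : x < N :=
      List.mem_range.1 (hp.subset (List.mem_flatten.2 ⟨_, List.getElem_mem k.is_lt, hx⟩))
    exact ⟨⟨x, this⟩, hx⟩
  choose x hx using hmem
  let φ : Fin K.length → Quotient (cycleSetoid γ) := fun k => Quotient.mk _ (x k)
  have hφ : Function.Bijective φ := by
    constructor
    · intro k k' h
      obtain ⟨t, -, ht⟩ := Perm.SameCycle.exists_pow_eq' (Quotient.exact h : γ.SameCycle _ _)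
      have hpow : ∀ t : ℕ, (((γ ^ t) (x k) : Fin N) : ℕ) ∈ K[k] := by
        intro t
        induction t with
        | zero => exact hx k
        | succ t ih =>
          rw [pow_succ', Perm.mul_apply, ← natExtend_apply]
          exact (hcl k).apply_mem ih
      have h1 := hpow t
      rw [ht] at h1
      by_contra hne
      rw [List.pairwise_iff_getElem] at hdisj
      rcases lt_or_gt_of_ne hne with hlt | hlt
      · exact hdisj k k' k.is_lt k'.is_lt hlt h1 (hx k')
      · exact hdisj k' k k'.is_lt k.is_lt hlt (hx k') h1
    · intro q
      induction q using Quotient.inductionOn with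
      | h y =>
        obtain ⟨l, hl, hy⟩ := List.mem_flatten.1 (hp.symm.subset (List.mem_range.2 y.is_lt))
        obtain ⟨k, hk, rfl⟩ := List.getElem_of_mem hl
        exact ⟨⟨k, hk⟩, Quotient.sound
          (sameCycle_natExtend.1 ((hcl ⟨k, hk⟩).sameCycle (hx ⟨k, hk⟩) hy))⟩
  rw [zPerm, ← Nat.card_congr (Equiv.ofBijective φ hφ), Nat.card_eq_fintype_card,
    Fintype.card_fin]

lemma card_eq_blockCount_add {n : ℕ} {β : ℕ → ℕ} {L : List ℕ} {Ls : List (List ℕ)}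
    {M : Finset ℕ} (h : FaceLists n β L Ls) (h0 : 0 ∈ M) (hM : ∀ b ∈ M, b < n + 1) :
    M.card = 1 + blockCount M L + (Ls.map (blockCount M)).sum := by
  have hcount : ∀ l : List ℕ,
      (l.map fun p => if p + 1 ∈ M then 1 else 0).sum = blockCount M l := fun l => by
    rw [sum_map_eq_blockCount_mul (c := 1) (fun p _ hp => if_neg hp) (fun p _ hp => if_pos hp),
      mul_one]
  rw [Finset.card_eq_sum_ones, sum_cycleMins h h0 hM]
  simp only [hcount]

lemma isGenusOne_iff_of_hasState {n i : ℕ} {m : List ℕ} {γ : Perm (Fin (n + 1))}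
    (h : HasState n (natExtend γ) i m) :
    IsGenusOne γ ↔ i + m.sum + m.length + 2 = n := by
  obtain ⟨-, L, Ls, hF, rfl, rfl⟩ := h
  have h1 := card_eq_blockCount_add hF (zero_mem_cycleMins n (natExtend γ))
    fun b => lt_of_mem_cycleMins
  have h2 : zPerm (γ⁻¹ * finRotate (n + 1)) = Ls.length + 1 := by
    have hF' := hF
    rw [facePerm_natExtend] at hF'
    refine zPerm_eq_length (K := (L ++ [n]) :: Ls) (by simpa using hF'.perm) ?_
    rintro l (_ | ⟨_, hl⟩)
    · exact ⟨n, L, rfl, hF'.run⟩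
    · exact hF'.cycles l hl
  rw [IsGenusOne, h2, zPerm_eq_card_cycleMins, h1, List.length_map]
  omega

end Genus

section Count

open Equiv

open Classical in
/-- The number of permutations of genus one obtained from the partition permutation `α` of
`{0, …, N - 1}` by successively inserting `r` further points. -/
noncomputable def genusOneDescendants : ℕ → ℕ → Perm ℕ → ℕ
  | 0, N, α => if ∃ γ : Perm (Fin N), IsGenusOne γ ∧ natExtend γ = α then 1 else 0
  | r + 1, N, α => ∑ b ∈ insert N (cycleMins N α), genusOneDescendants r (N + 1) (swap b N * α)

lemma genusOneDescendants_zero {n i : ℕ} {α : Perm ℕ} {m : List ℕ} (h : HasState n α i m) :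
    genusOneDescendants 0 (n + 1) α = if i + m.sum + m.length + 2 = n then 1 else 0 := by
  obtain ⟨γ, rfl⟩ := exists_natExtend_eq h.1
  classical
  rw [genusOneDescendants]
  refine if_congr ?_ rfl rfl
  rw [← isGenusOne_iff_of_hasState h]
  exact ⟨fun ⟨γ', h1, h2⟩ => natExtend_injective h2 ▸ h1, fun h => ⟨γ, h, rfl⟩⟩

lemma genusOneDescendants_eq_zero {r n i : ℕ} {α : Perm ℕ} {m : List ℕ} (h : HasState n α i m)
    (hn : i + m.sum + m.length + 2 < n) : genusOneDescendants r (n + 1) α = 0 := by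
  induction r generalizing n α i m with
  | zero => rw [genusOneDescendants_zero h, if_neg (by omega)]
  | succ r ih =>
    rw [genusOneDescendants, sum_insert_of_hasState h (f := 0) (h := 0)]
    · simp
    · exact fun γ hγ => ih hγ (by omega)
    · refine fun γ j hj hγ => ih hγ ?_
      simp only [List.sum_cons, List.length_cons]
      omega
    · exact fun γ c m' _ hm hγ => ih hγ (by omega)

lemma genusOneDescendants_eq_stableWalks {r n i : ℕ} {α : Perm ℕ} {m : List ℕ}
    (h : HasState n α i m) (hn : i + m.sum + m.length + 2 = n) :
    genusOneDescendants r (n + 1) α = stableWalks r i := by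
  induction r generalizing n α i m with
  | zero => rw [genusOneDescendants_zero h, if_pos hn, stableWalks]
  | succ r ih =>
    rw [genusOneDescendants, sum_insert_of_hasState h (f := stableWalks r) (h := 0), stableWalks]
    · simp
    · exact fun γ hγ => ih hγ (by omega)
    · refine fun γ j hj hγ => ih hγ ?_
      simp only [List.sum_cons, List.length_cons]
      omega
    · exact fun γ c m' _ hm hγ => genusOneDescendants_eq_zero hγ (by omega)

lemma pendingWalks_zero_right (r i : ℕ) : pendingWalks r i 0 = 0 := by
  induction r generalizing i with
  | zero => rw [pendingWalks]
  | succ r ih => simp [pendingWalks, ih]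

lemma genusOneDescendants_eq_freeWalks {r n i : ℕ} {α : Perm ℕ} {m : List ℕ}
    (h : HasState n α i m) (hn : i + m.sum + m.length = n) :
    genusOneDescendants r (n + 1) α = freeWalks r i + (m.map (pendingWalks r i)).sum := by
  induction r generalizing n α i m with
  | zero =>
    rw [genusOneDescendants_zero h, if_neg (by omega), freeWalks]
    simp [pendingWalks]
  | succ r ih =>
    rw [genusOneDescendants, sum_insert_of_hasState h
      (f := fun j => freeWalks r j + pendingWalks r j (i - j) + (m.map (pendingWalks r j)).sum)
      (h := fun c => stableWalks r (i + c))]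
    · have hsum : (m.map (pendingWalks (r + 1) i)).sum =
          (m.map fun c => c * stableWalks r (i + c)).sum +
            ∑ j ∈ Finset.range (i + 2), (m.map (pendingWalks r j)).sum := by
        clear h hn
        induction m with
        | nil => simp
        | cons c m ihm =>
          rw [List.map_cons, List.sum_cons, ihm, pendingWalks]
          simp only [List.map_cons, List.sum_cons, Finset.sum_add_distrib]
          omega
      have hlast : ∑ j ∈ Finset.range (i + 2), pendingWalks r j (i - j) =
          ∑ j ∈ Finset.range (i + 1), pendingWalks r j (i - j) := by
        rw [Finset.sum_range_succ, Nat.sub_eq_zero_of_le (Nat.le_succ i),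
          pendingWalks_zero_right, add_zero]
      rw [Finset.sum_add_distrib, Finset.sum_add_distrib, hlast, hsum, freeWalks]
      omega
    · intro γ hγ
      rw [ih hγ (by omega), Nat.sub_eq_zero_of_le (Nat.le_succ i), pendingWalks_zero_right,
        add_zero]
    · intro γ j hj hγ
      rw [ih hγ (by simp only [List.sum_cons, List.length_cons]; omega), List.map_cons,
        List.sum_cons, add_assoc]
    · exact fun γ c m' _ hm hγ => genusOneDescendants_eq_stableWalks hγ (by omega)

lemma hasState_one : HasState 0 1 0 [] := by
  refine ⟨fun _ _ => rfl, [], [], ⟨by simp, ?_, by simp⟩, rfl, rfl⟩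
  simp [IsRun, facePerm, natRotate_apply]

lemma sum_partitionPerms_genusOneDescendants (r N : ℕ) :
    ∑ α ∈ partitionPerms N, genusOneDescendants r N α =
      ∑ α ∈ partitionPerms (N + r), genusOneDescendants 0 (N + r) α := by
  induction r generalizing N with
  | zero => rfl
  | succ r ih =>
    rw [← add_assoc, add_right_comm, ← ih, sum_partitionPerms_succ]
    rfl

lemma card_eq_sum_genusOneDescendants (N : ℕ) :
    Nat.card {γ : Perm (Fin N) // IsGenusOne γ ∧ IsPartitionPerm γ} =
      ∑ α ∈ partitionPerms N, genusOneDescendants 0 N α := by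
  classical
  simp only [genusOneDescendants]
  rw [← Finset.sum_filter, ← Finset.card_eq_sum_ones, Nat.card_eq_fintype_card,
    Fintype.card_subtype, ← Finset.card_image_of_injective _ natExtend_injective]
  congr 1
  ext α
  simp only [Finset.mem_image, Finset.mem_filter, Finset.mem_univ, true_and, mem_partitionPerms]
  constructor
  · rintro ⟨γ, ⟨h1, h2⟩, rfl⟩
    exact ⟨⟨fun i hi => natExtend_apply_of_le γ hi, (noBackPoint_natExtend_iff γ).2 h2⟩,
      γ, h1, rfl⟩
  · rintro ⟨⟨-, h2⟩, γ, h1, rfl⟩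
    exact ⟨γ, ⟨h1, (noBackPoint_natExtend_iff γ).1 h2⟩, rfl⟩

lemma partitionPerms_one : partitionPerms 1 = {1} := by
  ext α
  simp [partitionPerms, cycleMins, Perm.one_def.symm]

lemma card_genusOne_partitions (r : ℕ) :
    Nat.card {γ : Perm (Fin (r + 1)) // IsGenusOne γ ∧ IsPartitionPerm γ} = freeWalks r 0 := by
  rw [card_eq_sum_genusOneDescendants, add_comm r 1, ← sum_partitionPerms_genusOneDescendants,
    partitionPerms_one, Finset.sum_singleton,
    genusOneDescendants_eq_freeWalks (n := 0) hasState_one rfl]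
  rfl

end Count

/-- For `n ≥ 4`, the number `p₀(n)` of genus-one set partitions of `{1,…,n}` satisfies
`6·(n−4)!·(n−3)!·p₀(n) = (2n−5)!`. -/
theorem genus_one_partition_total (n : ℕ) (hn : 4 ≤ n) :
    6 * (n - 4).factorial * (n - 3).factorial *
        Nat.card {α : Equiv.Perm (Fin n) // IsGenusOne α ∧ IsPartitionPerm α} =
      (2 * n - 5).factorial := by
  obtain ⟨m, rfl⟩ := Nat.exists_eq_add_of_le' hn
  rw [card_genusOne_partitions (m + 3), show m + 4 - 4 = m by omega,
    show m + 4 - 3 = m + 1 by omega, show 2 * (m + 4) - 5 = 2 * m + 3 by omega]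
  exact freeWalks_closed m
end

section
/- For all integers n ≥ 1 and k ≥ 1, if p_*(n,k) denotes the number of permutations of {1,…,n} of genus 1 having exactly k cycles, then 6·p_*(n,k) = C(n+1,2)·C(n−1,k+1)·C(n−1,k−1), where C(a,b) denotes the binomial coefficient. -/
open Equiv Equiv.Perm Finset

section Cycles

variable {X : Type*} [Fintype X] [DecidableEq X]

/-- The cycle of `σ` through `a`, as a finset. -/
def cyc (σ : Perm X) (a : X) : Finset X := univ.filter fun x => σ.SameCycle a x

/-- The finset of all cycles of `σ`. -/
def cycles (σ : Perm X) : Finset (Finset X) := univ.image (cyc σ)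

@[simp] lemma mem_cyc {σ : Perm X} {a x : X} : x ∈ cyc σ a ↔ σ.SameCycle a x := by simp [cyc]

lemma self_mem_cyc (σ : Perm X) (a : X) : a ∈ cyc σ a :=
  mem_cyc.mpr (SameCycle.refl _ _)

lemma cyc_eq_iff {σ : Perm X} {a b : X} : cyc σ a = cyc σ b ↔ σ.SameCycle a b := by
  constructor
  · intro h
    have : b ∈ cyc σ a := h ▸ self_mem_cyc σ b
    simpa using this
  · intro h
    ext x
    simp only [mem_cyc]
    exact ⟨fun h' => h.symm.trans h', fun h' => h.trans h'⟩

lemma cyc_mem_cycles (σ : Perm X) (a : X) : cyc σ a ∈ cycles σ := mem_image_of_mem _ (mem_univ _)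

lemma card_quotient_sameCycle (σ : Perm X) :
    Nat.card (Quotient (SameCycle.setoid σ)) = #(cycles σ) := by
  have e : Quotient (SameCycle.setoid σ) ≃ Set.range (cyc σ) :=
    (Quotient.congrRight fun a b => by
      rw [Setoid.ker_def, cyc_eq_iff]; rfl).trans (Setoid.quotientKerEquivRange (cyc σ))
  rw [Nat.card_congr e, Nat.card_coe_set_eq, ← Set.ncard_coe_finset, cycles, coe_image, coe_univ,
    Set.image_univ]

lemma card_cycles_pos (σ : Perm X) (a : X) : 0 < #(cycles σ) :=
  card_pos.mpr ⟨_, cyc_mem_cycles σ a⟩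

omit [DecidableEq X] in
lemma sameCycle_subset_of_invariant {σ : Perm X} {r : Setoid X} (h : ∀ x, r.r x (σ x)) {a b : X}
    (hab : σ.SameCycle a b) : r.r a b := by
  obtain ⟨i, rfl⟩ := hab.exists_nat_pow_eq
  clear hab
  induction i with
  | zero => exact r.refl _
  | succ i ih => rw [pow_succ', Perm.mul_apply]; exact r.trans ih (h _)

lemma cyc_subset_of_invariant {σ : Perm X} {S : Finset X} (h : ∀ x ∈ S, σ x ∈ S) {a : X}
    (ha : a ∈ S) : cyc σ a ⊆ S := by
  intro b hb
  obtain ⟨i, rfl⟩ := (mem_cyc.mp hb).exists_nat_pow_eq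
  clear hb
  induction i with
  | zero => exact ha
  | succ i ih => rw [pow_succ', Perm.mul_apply]; exact h _ ih

lemma pow_injOn_cyc (σ : Perm X) (a : X) :
    Set.InjOn (fun i : ℕ => (σ ^ i) a) (Set.Iio #(cyc σ a)) ∧
      (range #(cyc σ a)).image (fun i : ℕ => (σ ^ i) a) = cyc σ a := by
  have inj : Set.InjOn (fun i : ℕ => (σ ^ i) a) (Set.Iio (Function.minimalPeriod σ a)) := by
    simpa only [Perm.iterate_eq_pow] using
      Function.iterate_injOn_Iio_minimalPeriod (f := σ) (x := a)
  have im : (range (Function.minimalPeriod σ a)).image (fun i : ℕ => (σ ^ i) a) = cyc σ a := by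
    ext x
    simp only [mem_image, mem_range, mem_cyc]
    constructor
    · rintro ⟨i, -, rfl⟩
      exact ⟨i, by simp⟩
    · intro h
      obtain ⟨i, rfl⟩ := h.exists_nat_pow_eq
      refine ⟨i % Function.minimalPeriod σ a, Nat.mod_lt _ ?_, ?_⟩
      · apply Function.minimalPeriod_pos_of_mem_periodicPts
        exact σ.injective.mem_periodicPts a
      · rw [← Perm.iterate_eq_pow, ← Perm.iterate_eq_pow, Function.iterate_mod_minimalPeriod_eq]
  have hc : #(cyc σ a) = Function.minimalPeriod σ a := by
    rw [← im, card_image_of_injOn (by simpa using inj), card_range]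
  rw [hc]
  exact ⟨inj, im⟩

lemma pow_card_cyc (σ : Perm X) (a : X) : (σ ^ #(cyc σ a)) a = a := by
  obtain ⟨hinj, him⟩ := pow_injOn_cyc σ a
  have h : (σ ^ #(cyc σ a)) a ∈ cyc σ a := by
    simp only [mem_cyc]; exact ⟨#(cyc σ a), by simp⟩
  obtain ⟨i, hi, h⟩ := mem_image.mp (him.symm.subset h)
  rw [mem_range] at hi
  rcases Nat.eq_zero_or_pos i with rfl | hi0
  · simpa using h.symm
  · exfalso
    obtain ⟨i, rfl⟩ : ∃ j, i = j + 1 := ⟨i - 1, by omega⟩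
    obtain ⟨c, hc⟩ : ∃ c, #(cyc σ a) = c + 1 := ⟨#(cyc σ a) - 1, by omega⟩
    rw [hc] at h hinj hi
    simp only [pow_succ', Perm.mul_apply] at h
    have := hinj (show i < c + 1 by omega) (show c < c + 1 by omega) (σ.injective h)
    omega

/-- Multiplying by a transposition of two points in different cycles joins these cycles. -/
lemma sameCycle_swap_mul {σ : Perm X} {a b : X} (h : ¬ σ.SameCycle a b) (x y : X) :
    (swap a b * σ).SameCycle x y ↔ σ.SameCycle x y ∨
      (σ.SameCycle a x ∧ σ.SameCycle b y) ∨ (σ.SameCycle b x ∧ σ.SameCycle a y) := by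
  have hab : a ≠ b := fun e => h (e ▸ SameCycle.refl _ _)
  constructor
  · let r : Setoid X := ⟨fun x y => σ.SameCycle x y ∨
      (σ.SameCycle a x ∧ σ.SameCycle b y) ∨ (σ.SameCycle b x ∧ σ.SameCycle a y),
      fun x => Or.inl (SameCycle.refl _ _), by
        rintro x y (h1 | h1 | h1)
        · exact Or.inl h1.symm
        · exact Or.inr (Or.inr h1.symm)
        · exact Or.inr (Or.inl h1.symm), by
        rintro x y z (h1 | ⟨h1, h1'⟩ | ⟨h1, h1'⟩) (h2 | ⟨h2, h2'⟩ | ⟨h2, h2'⟩)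
        · exact Or.inl (h1.trans h2)
        · exact Or.inr (Or.inl ⟨h2.trans h1.symm, h2'⟩)
        · exact Or.inr (Or.inr ⟨h2.trans h1.symm, h2'⟩)
        · exact Or.inr (Or.inl ⟨h1, h1'.trans h2⟩)
        · exact absurd (h2.trans h1'.symm) h
        · exact Or.inl (h1.symm.trans h2')
        · exact Or.inr (Or.inr ⟨h1, h1'.trans h2⟩)
        · exact Or.inl (h1.symm.trans h2')
        · exact absurd (h1'.trans h2.symm) h⟩
    intro hxy
    refine sameCycle_subset_of_invariant (r := r) (fun x => ?_) hxy
    change σ.SameCycle _ _ ∨ _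
    rw [Perm.mul_apply]
    by_cases h1 : σ x = a
    · rw [h1, swap_apply_left]
      exact Or.inr (Or.inl ⟨h1 ▸ (sameCycle_apply_left.mpr (SameCycle.refl _ _)),
        SameCycle.refl _ _⟩)
    by_cases h2 : σ x = b
    · rw [h2, swap_apply_right]
      exact Or.inr (Or.inr ⟨h2 ▸ (sameCycle_apply_left.mpr (SameCycle.refl _ _)),
        SameCycle.refl _ _⟩)
    rw [swap_apply_of_ne_of_ne h1 h2]
    exact Or.inl (sameCycle_apply_right.mpr (SameCycle.refl _ _))
  · set τ := swap a b * σ with hτ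
    have key : τ.SameCycle a b := by
      obtain ⟨hinj, -⟩ := pow_injOn_cyc σ b
      have hpos : 0 < #(cyc σ b) := card_pos.mpr ⟨_, self_mem_cyc σ b⟩
      have hpow : ∀ j < #(cyc σ b), (τ ^ j) b = (σ ^ j) b := by
        intro j hj
        induction j with
        | zero => simp
        | succ j ih =>
          rw [pow_succ', Perm.mul_apply, ih (by omega), hτ, Perm.mul_apply, ← Perm.mul_apply σ,
            ← pow_succ', swap_apply_of_ne_of_ne]
          · rintro e
            exact h (SameCycle.symm ⟨(j + 1 : ℕ), by rw [zpow_natCast]; exact e⟩)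
          · intro e
            have := hinj (show j + 1 < _ from hj) (show 0 < _ from hpos) (by simpa using e)
            omega
      refine SameCycle.symm ⟨(#(cyc σ b) : ℕ), ?_⟩
      obtain ⟨c, hc⟩ : ∃ c, #(cyc σ b) = c + 1 := ⟨#(cyc σ b) - 1, by omega⟩
      have e := pow_card_cyc σ b
      rw [zpow_natCast, hc, pow_succ', Perm.mul_apply, hpow c (by omega), hτ, Perm.mul_apply,
        ← Perm.mul_apply σ, ← pow_succ', ← hc, e, swap_apply_right]
    have sub : ∀ {x y}, σ.SameCycle x y → τ.SameCycle x y := by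
      intro x y hxy
      refine sameCycle_subset_of_invariant (r := SameCycle.setoid τ) (fun x => ?_) hxy
      change τ.SameCycle _ _
      have h0 : τ.SameCycle x (τ x) := sameCycle_apply_right.mpr (SameCycle.refl _ _)
      have h3 : τ x = swap a b (σ x) := rfl
      by_cases h1 : σ x = a
      · rw [h1, swap_apply_left] at h3
        rw [h1]; exact (h3 ▸ h0).trans key.symm
      by_cases h2 : σ x = b
      · rw [h2, swap_apply_right] at h3
        rw [h2]; exact (h3 ▸ h0).trans key
      rw [swap_apply_of_ne_of_ne h1 h2] at h3
      rwa [← h3]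
    rintro (h1 | ⟨h1, h2⟩ | ⟨h1, h2⟩)
    · exact sub h1
    · exact (sub h1).symm.trans (key.trans (sub h2))
    · exact (sub h1).symm.trans (key.symm.trans (sub h2))

lemma cyc_swap_mul_left {σ : Perm X} {a b : X} (h : ¬ σ.SameCycle a b) :
    cyc (swap a b * σ) a = cyc σ a ∪ cyc σ b := by
  ext x
  simp only [mem_cyc, sameCycle_swap_mul h, mem_union]
  constructor
  · rintro (h1 | ⟨-, h1⟩ | ⟨h1, -⟩)
    · exact Or.inl h1
    · exact Or.inr h1
    · exact absurd h1.symm h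
  · rintro (h1 | h1)
    · exact Or.inl h1
    · exact Or.inr (Or.inl ⟨SameCycle.refl _ _, h1⟩)

lemma cyc_swap_mul_of_not {σ : Perm X} {a b x : X} (h : ¬ σ.SameCycle a b)
    (ha : ¬ σ.SameCycle a x) (hb : ¬ σ.SameCycle b x) : cyc (swap a b * σ) x = cyc σ x := by
  ext y
  simp [sameCycle_swap_mul h, ha, hb]

lemma disjoint_cyc {σ : Perm X} {a b : X} (h : ¬ σ.SameCycle a b) :
    Disjoint (cyc σ a) (cyc σ b) := by
  rw [disjoint_left]
  intro x hx hx'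
  exact h ((mem_cyc.mp hx).trans (mem_cyc.mp hx').symm)

lemma card_cyc_swap_mul_left {σ : Perm X} {a b : X} (h : ¬ σ.SameCycle a b) :
    #(cyc (swap a b * σ) a) = #(cyc σ a) + #(cyc σ b) := by
  rw [cyc_swap_mul_left h, card_union_of_disjoint (disjoint_cyc h)]

lemma card_cycles_swap_mul {σ : Perm X} {a b : X} (h : ¬ σ.SameCycle a b) :
    #(cycles (swap a b * σ)) + 1 = #(cycles σ) := by
  have key : cycles (swap a b * σ) =
      insert (cyc σ a ∪ cyc σ b) (((cycles σ).erase (cyc σ a)).erase (cyc σ b)) := by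
    ext S
    simp only [cycles, mem_image, mem_univ, true_and, mem_insert, mem_erase]
    constructor
    · rintro ⟨x, rfl⟩
      by_cases ha : σ.SameCycle a x
      · left
        rw [← cyc_swap_mul_left h, cyc_eq_iff, sameCycle_swap_mul h]
        exact Or.inl ha.symm
      by_cases hb : σ.SameCycle b x
      · left
        rw [← cyc_swap_mul_left h, cyc_eq_iff, sameCycle_swap_mul h]
        exact Or.inr (Or.inr ⟨hb, SameCycle.refl _ _⟩)
      right
      rw [cyc_swap_mul_of_not h ha hb]
      exact ⟨fun e => hb (cyc_eq_iff.mp e).symm, fun e => ha (cyc_eq_iff.mp e).symm, x, rfl⟩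
    · rintro (rfl | ⟨hb, ha, x, rfl⟩)
      · exact ⟨a, cyc_swap_mul_left h⟩
      · refine ⟨x, cyc_swap_mul_of_not h (fun e => ha (cyc_eq_iff.mpr e.symm))
          (fun e => hb (cyc_eq_iff.mpr e.symm))⟩
  have hne : cyc σ b ≠ cyc σ a := fun e => h (cyc_eq_iff.mp e).symm
  have hmem : cyc σ b ∈ (cycles σ).erase (cyc σ a) := mem_erase.mpr ⟨hne, cyc_mem_cycles σ b⟩
  have c1 := card_erase_add_one hmem
  have c2 := card_erase_add_one (cyc_mem_cycles σ a)
  rw [key, card_insert_of_notMem]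
  · omega
  · simp only [cycles, mem_image, mem_univ, true_and, mem_erase, not_and, not_exists]
    intro _ _ x hx
    have ha : a ∈ cyc σ x := by rw [hx]; exact mem_union_left _ (self_mem_cyc σ a)
    have hb : b ∈ cyc σ x := by rw [hx]; exact mem_union_right _ (self_mem_cyc σ b)
    exact h ((mem_cyc.mp ha).symm.trans (mem_cyc.mp hb))

/-- Multiplying by a transposition of two points of the same cycle cuts this cycle. -/
lemma cut_cycle {σ : Perm X} {a : X} {i : ℕ} (hi : 0 < i) (hi' : i < #(cyc σ a)) :
    #(cyc (swap a ((σ ^ i) a) * σ) a) = i ∧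
      ¬ (swap a ((σ ^ i) a) * σ).SameCycle a ((σ ^ i) a) := by
  obtain ⟨hinj, -⟩ := pow_injOn_cyc σ a
  set b := (σ ^ i) a with hb
  set τ := swap a b * σ with hτ
  have hpow : ∀ j < i, (τ ^ j) a = (σ ^ j) a := by
    intro j hj
    induction j with
    | zero => simp
    | succ j ih =>
      rw [pow_succ', Perm.mul_apply, ih (by omega), hτ, Perm.mul_apply, ← Perm.mul_apply σ,
        ← pow_succ', swap_apply_of_ne_of_ne]
      · rintro e
        have := hinj (show j + 1 < #(cyc σ a) by omega) (show 0 < #(cyc σ a) by omega)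
          (by simpa using e)
        omega
      · intro e
        have := hinj (show j + 1 < #(cyc σ a) by omega) (show i < #(cyc σ a) by omega) e
        omega
  set S := (range i).image (fun j => (σ ^ j) a) with hS
  have hcard : #S = i := by
    rw [hS, card_image_of_injOn, card_range]
    exact hinj.mono (by intro j hj; simp at hj ⊢; omega)
  have hcyc : cyc τ a = S := by
    apply Subset.antisymm
    · apply cyc_subset_of_invariant
      · intro x hx
        obtain ⟨j, hj, rfl⟩ := mem_image.mp hx
        rw [mem_range] at hj
        rcases Nat.lt_or_ge (j + 1) i with h | h
        · refine mem_image.mpr ⟨j + 1, by simpa using h, ?_⟩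
          rw [← hpow _ h, ← hpow _ hj, pow_succ', Perm.mul_apply]
        · refine mem_image.mpr ⟨0, by simpa using hi, ?_⟩
          have : i = j + 1 := by omega
          rw [hτ, Perm.mul_apply, ← Perm.mul_apply σ, ← pow_succ', ← this, ← hb,
            swap_apply_right]
          simp
      · exact mem_image.mpr ⟨0, by simpa using hi, by simp⟩
    · intro x hx
      obtain ⟨j, hj, rfl⟩ := mem_image.mp hx
      rw [mem_range] at hj
      rw [← hpow j hj, mem_cyc]
      exact ⟨j, by simp⟩
  refine ⟨by rw [hcyc, hcard], fun h => ?_⟩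
  rw [← mem_cyc, hcyc] at h
  obtain ⟨j, hj, e⟩ := mem_image.mp h
  rw [mem_range] at hj
  have := hinj (show j < #(cyc σ a) by omega) (show i < #(cyc σ a) by omega) e
  omega

end Cycles

section Marked

variable {X : Type*} [Fintype X] [DecidableEq X]

/-- The number of points outside the cycle of `σ` through `a`. -/
def outCard (σ : Perm X) (a : X) : ℕ := #(cyc σ a)ᶜ

/-- The number of points outside the cycle of `σ` through `a` lying on a cycle of length `l`. -/
def outCount (σ : Perm X) (a : X) (l : ℕ) : ℕ := #((cyc σ a)ᶜ.filter fun x => #(cyc σ x) = l)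

lemma outCard_add_card_cyc (σ : Perm X) (a : X) :
    outCard σ a + #(cyc σ a) = Fintype.card X := by
  rw [outCard, add_comm, card_add_card_compl]

lemma card_cyc_pos (σ : Perm X) (a : X) : 0 < #(cyc σ a) := card_pos.mpr ⟨_, self_mem_cyc σ a⟩

lemma outCard_lt (σ : Perm X) (a : X) : outCard σ a < Fintype.card X := by
  have := outCard_add_card_cyc σ a
  have := card_cyc_pos σ a
  omega

lemma outCard_congr {σ : Perm X} {a b : X} (h : σ.SameCycle a b) :
    outCard σ a = outCard σ b := by
  rw [outCard, outCard, cyc_eq_iff.mpr h]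

lemma outCount_congr {σ : Perm X} {a b : X} (h : σ.SameCycle a b) (l : ℕ) :
    outCount σ a l = outCount σ b l := by
  rw [outCount, outCount, cyc_eq_iff.mpr h]

lemma outCount_zero (σ : Perm X) (a : X) : outCount σ a 0 = 0 := by
  rw [outCount, card_eq_zero, filter_eq_empty_iff]
  exact fun x _ => (card_cyc_pos σ x).ne'

lemma le_outCard_of_outCount_ne_zero {σ : Perm X} {a : X} {l : ℕ} (h : outCount σ a l ≠ 0) :
    l ≤ outCard σ a := by
  obtain ⟨x, hx⟩ := card_pos.mp (Nat.pos_of_ne_zero h)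
  simp only [mem_filter, mem_compl, mem_cyc] at hx
  rw [← hx.2]
  refine card_le_card fun y hy => ?_
  rw [mem_compl]
  exact disjoint_left.mp (disjoint_cyc hx.1).symm hy

lemma sum_compl_cyc (σ : Perm X) (a : X) (f : ℕ → ℚ) :
    ∑ x ∈ (cyc σ a)ᶜ, f #(cyc σ x) =
      ∑ l ∈ range (Fintype.card X + 1), (outCount σ a l : ℚ) * f l := by
  rw [← sum_fiberwise_of_maps_to (s := (cyc σ a)ᶜ) (t := range (Fintype.card X + 1))
    (g := fun x => #(cyc σ x)) (fun x _ => by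
      have := card_le_univ (cyc σ x)
      rw [mem_range]
      omega)]
  refine sum_congr rfl fun l _ => ?_
  rw [sum_congr rfl fun x hx => by rw [(mem_filter.mp hx).2], sum_const, nsmul_eq_mul, outCount]

lemma sum_eq_sum_cyc_add_sum_compl (σ : Perm X) (a : X) (f : X → ℚ) :
    ∑ x, f x = f a + ∑ i ∈ range (#(cyc σ a) - 1), f ((σ ^ (i + 1)) a) +
      ∑ x ∈ (cyc σ a)ᶜ, f x := by
  obtain ⟨hinj, him⟩ := pow_injOn_cyc σ a
  rw [← sum_add_sum_compl (cyc σ a)]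
  congr 1
  conv_lhs => rw [← him]
  rw [sum_image (by simpa using hinj)]
  obtain ⟨c, hc⟩ : ∃ c, #(cyc σ a) = c + 1 := ⟨#(cyc σ a) - 1, by have := card_cyc_pos σ a; omega⟩
  rw [hc, sum_range_succ']
  simp [add_comm]

lemma cut_stats {σ : Perm X} {a : X} {i : ℕ} (hi : 0 < i) (hi' : i < #(cyc σ a)) :
    #(cycles (swap a ((σ ^ i) a) * σ)) = #(cycles σ) + 1 ∧
      outCard (swap a ((σ ^ i) a) * σ) ((σ ^ i) a) = outCard σ a + i ∧
      ∀ l, outCount (swap a ((σ ^ i) a) * σ) ((σ ^ i) a) l =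
        outCount σ a l + if l = i then i else 0 := by
  obtain ⟨hcard, hnot⟩ := cut_cycle hi hi'
  set b := (σ ^ i) a
  set τ := swap a b * σ with hτ
  have hσ : swap a b * τ = σ := by simp [hτ, ← mul_assoc]
  have hcyc : cyc σ a = cyc τ a ∪ cyc τ b := by rw [← hσ]; exact cyc_swap_mul_left hnot
  have hdisj := disjoint_cyc hnot
  have hcompl : (cyc τ b)ᶜ = (cyc σ a)ᶜ ∪ cyc τ a := by
    rw [hcyc]
    ext x
    have := @disjoint_left _ (cyc τ a) (cyc τ b)
    simp only [hdisj, true_iff] at this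
    have := @this x
    simp only [mem_compl, mem_union]
    tauto
  have hd : Disjoint (cyc σ a)ᶜ (cyc τ a) := by
    rw [disjoint_left]
    intro x hx hx'
    rw [mem_compl, hcyc] at hx
    exact hx (mem_union_left _ hx')
  refine ⟨?_, ?_, fun l => ?_⟩
  · rw [← hσ, card_cycles_swap_mul hnot]
  · rw [outCard, outCard, hcompl, card_union_of_disjoint hd, hcard]
  · rw [outCount, outCount, hcompl, filter_union, card_union_of_disjoint]
    · congr 1
      · congr 1
        refine filter_congr fun x hx => ?_
        rw [mem_compl, hcyc, mem_union, not_or, mem_cyc, mem_cyc] at hx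
        rw [← hσ, cyc_swap_mul_of_not hnot hx.1 hx.2]
      · have : ∀ x ∈ cyc τ a, #(cyc τ x) = i := fun x hx => by
          rw [← hcard, cyc_eq_iff.mpr (mem_cyc.mp hx)]
        split_ifs with h
        · rw [filter_true_of_mem fun x hx => (this x hx).trans h.symm, hcard]
        · rw [filter_false_of_mem fun x hx e => h (e.symm.trans (this x hx)), card_empty]
    · exact disjoint_filter_filter hd

lemma join_stats {σ : Perm X} {a b : X} (h : ¬ σ.SameCycle a b) :
    #(cycles (swap a b * σ)) + 1 = #(cycles σ) ∧
      outCard (swap a b * σ) a + #(cyc σ b) = outCard σ a := by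
  refine ⟨card_cycles_swap_mul h, ?_⟩
  have h1 := outCard_add_card_cyc σ a
  have h2 := outCard_add_card_cyc (swap a b * σ) a
  rw [card_cyc_swap_mul_left h] at h2
  omega

end Marked

section Insert

/-- The extension of a permutation of `Fin n` to `Fin (n + 1)` fixing `0`. -/
def liftPerm {n : ℕ} (σ : Perm (Fin n)) : Perm (Fin (n + 1)) := decomposeFin.symm (0, σ)

@[simp] lemma liftPerm_zero {n : ℕ} (σ : Perm (Fin n)) : liftPerm σ 0 = 0 := by simp [liftPerm]

@[simp] lemma liftPerm_succ {n : ℕ} (σ : Perm (Fin n)) (x : Fin n) :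
    liftPerm σ x.succ = (σ x).succ := by simp [liftPerm]

lemma decomposeFin_symm_eq {n : ℕ} (p : Fin (n + 1)) (σ : Perm (Fin n)) :
    decomposeFin.symm (p, σ) = swap 0 p * liftPerm σ := by
  ext x; refine Fin.cases ?_ (fun x => ?_) x <;> simp

lemma liftPerm_pow_zero {n : ℕ} (σ : Perm (Fin n)) (i : ℕ) : (liftPerm σ ^ i) 0 = 0 := by
  induction i with
  | zero => simp
  | succ i ih => rw [pow_succ', Perm.mul_apply, ih, liftPerm_zero]

lemma liftPerm_pow_succ {n : ℕ} (σ : Perm (Fin n)) (i : ℕ) (x : Fin n) :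
    (liftPerm σ ^ i) x.succ = ((σ ^ i) x).succ := by
  induction i with
  | zero => simp
  | succ i ih => rw [pow_succ', Perm.mul_apply, ih, liftPerm_succ, pow_succ', Perm.mul_apply]

lemma not_sameCycle_liftPerm {n : ℕ} (σ : Perm (Fin n)) (x : Fin n) :
    ¬ (liftPerm σ).SameCycle 0 x.succ := by
  intro h
  obtain ⟨i, hi⟩ := h.exists_nat_pow_eq
  rw [liftPerm_pow_zero] at hi
  exact Fin.succ_ne_zero x hi.symm

lemma sameCycle_liftPerm {n : ℕ} (σ : Perm (Fin n)) (x y : Fin n) :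
    (liftPerm σ).SameCycle x.succ y.succ ↔ σ.SameCycle x y := by
  constructor
  · intro h
    obtain ⟨i, hi⟩ := h.exists_nat_pow_eq
    rw [liftPerm_pow_succ] at hi
    exact ⟨i, by simpa using hi⟩
  · intro h
    obtain ⟨i, hi⟩ := h.exists_nat_pow_eq
    exact ⟨i, by rw [zpow_natCast, liftPerm_pow_succ, hi]⟩

lemma cyc_liftPerm_zero {n : ℕ} (σ : Perm (Fin n)) : cyc (liftPerm σ) 0 = {0} := by
  ext x
  refine Fin.cases ?_ (fun x => ?_) x
  · simp [SameCycle.refl]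
  · simp [not_sameCycle_liftPerm]

lemma cyc_liftPerm_succ {n : ℕ} (σ : Perm (Fin n)) (x : Fin n) :
    cyc (liftPerm σ) x.succ = (cyc σ x).map (Fin.succEmb n) := by
  ext y
  refine Fin.cases ?_ (fun y => ?_) y
  · simp only [mem_cyc, sameCycle_comm (x := x.succ), not_sameCycle_liftPerm]
    simp
  · simp [sameCycle_liftPerm]

lemma card_cycles_liftPerm {n : ℕ} (σ : Perm (Fin n)) :
    #(cycles (liftPerm σ)) = #(cycles σ) + 1 := by
  have : cycles (liftPerm σ) =
      insert {0} ((cycles σ).map (mapEmbedding (Fin.succEmb n)).toEmbedding) := by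
    ext S
    simp only [cycles, mem_image, mem_univ, true_and, mem_insert, mem_map, Fin.exists_fin_succ,
      cyc_liftPerm_zero, cyc_liftPerm_succ]
    simp [eq_comm]
  rw [this, card_insert_of_notMem, card_map]
  simp only [mem_map, not_exists, not_and]
  intro T _ h
  have : (0 : Fin (n + 1)) ∈ (mapEmbedding (Fin.succEmb n)).toEmbedding T := by rw [h]; simp
  simp at this

/-- The number of cycles after inserting `0`. -/
lemma card_cycles_decomposeFin_symm {n : ℕ} (p : Fin (n + 1)) (σ : Perm (Fin n)) :
    #(cycles (decomposeFin.symm (p, σ))) = #(cycles σ) + if p = 0 then 1 else 0 := by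
  refine Fin.cases ?_ (fun q => ?_) p
  · simp [← card_cycles_liftPerm, liftPerm]
  · rw [decomposeFin_symm_eq]
    have := card_cycles_swap_mul (not_sameCycle_liftPerm σ q)
    rw [card_cycles_liftPerm] at this
    simp; omega

/-- The second factor `γ * ζ` attached to `γ`. -/
abbrev dual {n : ℕ} (γ : Perm (Fin n)) : Perm (Fin n) := γ * finRotate n

/-- The dual of the extension of `γ` fixing `0`. -/
abbrev dualLift {m : ℕ} (γ : Perm (Fin (m + 1))) : Perm (Fin (m + 2)) := dual (liftPerm γ)

lemma dual_decomposeFin_symm {m : ℕ} (p : Fin (m + 2)) (γ : Perm (Fin (m + 1))) :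
    dual (decomposeFin.symm (p, γ)) = swap 0 p * dualLift γ := by
  rw [dual, dualLift, dual, decomposeFin_symm_eq, mul_assoc]

lemma dualLift_eq {m : ℕ} (γ : Perm (Fin (m + 1))) :
    dualLift γ = swap 0 (dual γ (Fin.last m)).succ * liftPerm (dual γ) := by
  have h : finRotate (m + 2) = swap 0 1 * liftPerm (finRotate (m + 1)) := by
    rw [← decomposeFin_symm_eq]; exact finRotate_succ_eq_decomposeFin
  have h1 : liftPerm γ * liftPerm (finRotate (m + 1)) = liftPerm (dual γ) := by
    ext x; refine Fin.cases ?_ (fun x => ?_) x <;> simp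
  rw [dualLift, dual, h, ← mul_assoc, Equiv.mul_swap_eq_swap_mul, mul_assoc, h1, liftPerm_zero]
  congr 2
  rw [← Fin.succ_zero_eq_one, liftPerm_succ]
  simp

lemma dualLift_last {m : ℕ} (γ : Perm (Fin (m + 1))) : dualLift γ (Fin.last (m + 1)) = 0 := by
  simp

lemma dualLift_stats {m : ℕ} (γ : Perm (Fin (m + 1))) :
    #(cycles (dualLift γ)) = #(cycles (dual γ)) ∧
      outCard (dualLift γ) 0 = outCard (dual γ) (Fin.last m) ∧
      ∀ l, outCount (dualLift γ) 0 l = outCount (dual γ) (Fin.last m) l := by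
  have hn := not_sameCycle_liftPerm (dual γ) (dual γ (Fin.last m))
  have hc := card_cycles_swap_mul hn
  have ho := card_cyc_swap_mul_left hn
  have hcl := cyc_swap_mul_left hn
  have hlast : cyc (dual γ) (dual γ (Fin.last m)) = cyc (dual γ) (Fin.last m) :=
    cyc_eq_iff.mpr (sameCycle_apply_left.mpr (SameCycle.refl _ _))
  rw [cyc_liftPerm_zero, cyc_liftPerm_succ, hlast] at hcl
  rw [cyc_liftPerm_zero, cyc_liftPerm_succ, card_map, card_singleton, hlast] at ho
  rw [card_cycles_liftPerm] at hc
  have h1 := outCard_add_card_cyc (dualLift γ) 0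
  have h2 := outCard_add_card_cyc (dual γ) (Fin.last m)
  have hcompl : (cyc (dualLift γ) 0)ᶜ = (cyc (dual γ) (Fin.last m))ᶜ.map (Fin.succEmb _) := by
    rw [dualLift_eq, hcl]
    ext x
    refine Fin.cases ?_ (fun x => ?_) x <;> simp
  rw [Fintype.card_fin] at h1 h2
  refine ⟨?_, ?_, fun l => ?_⟩
  · rw [dualLift_eq]; omega
  · rw [dualLift_eq] at h1 ⊢; omega
  · rw [outCount, outCount, hcompl, filter_map, card_map]
    congr 1
    refine filter_congr fun x hx => ?_
    rw [mem_compl, mem_cyc] at hx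
    have : cyc (dualLift γ) x.succ = (cyc (dual γ) x).map (Fin.succEmb _) := by
      rw [dualLift_eq, cyc_swap_mul_of_not hn (not_sameCycle_liftPerm _ _), cyc_liftPerm_succ]
      rwa [sameCycle_liftPerm, sameCycle_apply_left]
    simp [this]

/-- The effect on cycle statistics of all ways of inserting a point into `γ`. -/
lemma sum_insert {m : ℕ} (γ : Perm (Fin (m + 1))) (l : ℕ) (f : ℕ → ℕ → ℕ → ℕ → ℚ) :
    ∑ p : Fin (m + 2),
      f #(cycles (decomposeFin.symm (p, γ))) #(cycles (dual (decomposeFin.symm (p, γ))))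
        (outCard (dual (decomposeFin.symm (p, γ))) (Fin.last (m + 1)))
        (outCount (dual (decomposeFin.symm (p, γ))) (Fin.last (m + 1)) l) =
    f (#(cycles γ) + 1) #(cycles (dual γ)) (outCard (dual γ) (Fin.last m))
        (outCount (dual γ) (Fin.last m) l) +
      ∑ i ∈ range (m + 1 - outCard (dual γ) (Fin.last m)),
        f #(cycles γ) (#(cycles (dual γ)) + 1) (outCard (dual γ) (Fin.last m) + (i + 1))
          (outCount (dual γ) (Fin.last m) l + if l = i + 1 then i + 1 else 0) +
      ∑ p ∈ (cyc (dualLift γ) 0)ᶜ,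
        f #(cycles γ) (#(cycles (dual γ)) - 1)
          (outCard (dual γ) (Fin.last m) - #(cyc (dualLift γ) p))
          (outCount (swap 0 p * dualLift γ) 0 l) := by
  obtain ⟨hz, ho, hl⟩ := dualLift_stats γ
  have hs := outCard_add_card_cyc (dualLift γ) 0
  rw [ho, Fintype.card_fin] at hs
  have hlast : (dualLift γ).SameCycle 0 (Fin.last (m + 1)) := by
    rw [← dualLift_last γ]
    exact sameCycle_apply_left.mpr (SameCycle.refl _ _)
  rw [sum_eq_sum_cyc_add_sum_compl (dualLift γ) 0]
  congr 1
  congr 1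
  · rw [card_cycles_decomposeFin_symm, dual_decomposeFin_symm, swap_self]
    change f _ #(cycles (1 * dualLift γ)) (outCard (1 * dualLift γ) _)
      (outCount (1 * dualLift γ) _ l) = _
    rw [one_mul, ← outCard_congr hlast, ← outCount_congr hlast, hz, ho, hl, if_pos rfl]
  · have hc : #(cyc (dualLift γ) 0) - 1 = m + 1 - outCard (dual γ) (Fin.last m) := by omega
    rw [hc]
    refine sum_congr rfl fun i hi => ?_
    rw [mem_range] at hi
    obtain ⟨h1, h2, h3⟩ := cut_stats (σ := dualLift γ) (a := 0) (i := i + 1) (by omega) (by omega)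
    have hb : ((dualLift γ) ^ (i + 1)) 0 ≠ 0 := by
      intro e
      have := (pow_injOn_cyc (dualLift γ) 0).1 (show i + 1 < #(cyc (dualLift γ) 0) by omega)
        (card_cyc_pos (dualLift γ) 0) (by simpa using e)
      omega
    set b := ((dualLift γ) ^ (i + 1)) 0
    have hbl : (swap 0 b * dualLift γ).SameCycle b (Fin.last (m + 1)) := by
      have : (swap 0 b * dualLift γ) (Fin.last (m + 1)) = b := by
        rw [Perm.mul_apply, dualLift_last, swap_apply_left]
      nth_rewrite 2 [← this]
      exact sameCycle_apply_left.mpr (SameCycle.refl _ _)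
    rw [card_cycles_decomposeFin_symm, dual_decomposeFin_symm, if_neg hb, ← outCard_congr hbl,
      ← outCount_congr hbl, h1, h2, h3, hz, ho, hl, add_zero]
  · refine sum_congr rfl fun p hp => ?_
    rw [mem_compl, mem_cyc] at hp
    have hp0 : p ≠ 0 := fun e => hp (e ▸ SameCycle.refl _ _)
    obtain ⟨h1, h2⟩ := join_stats hp
    have hbl : (swap 0 p * dualLift γ).SameCycle 0 (Fin.last (m + 1)) :=
      (sameCycle_swap_mul hp _ _).mpr (Or.inl hlast)
    have e1 : #(cycles (swap 0 p * dualLift γ)) = #(cycles (dual γ)) - 1 := by omega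
    have e2 : outCard (swap 0 p * dualLift γ) 0 =
        outCard (dual γ) (Fin.last m) - #(cyc (dualLift γ) p) := by omega
    rw [card_cycles_decomposeFin_symm, dual_decomposeFin_symm, if_neg hp0, ← outCard_congr hbl,
      ← outCount_congr hbl, add_zero, e1, e2]

lemma sum_perm_succ {n : ℕ} (f : Perm (Fin (n + 1)) → ℚ) :
    ∑ σ, f σ = ∑ γ : Perm (Fin n), ∑ p, f (decomposeFin.symm (p, γ)) := by
  rw [← Equiv.sum_comp decomposeFin.symm, Fintype.sum_prod_type_right]

lemma card_cycles_add_le {m : ℕ} (γ : Perm (Fin (m + 1))) :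
    #(cycles γ) + #(cycles (dual γ)) ≤ m + 2 := by
  induction m with
  | zero =>
    have h : ∀ σ : Perm (Fin 1), #(cycles σ) ≤ 1 := fun σ =>
      card_image_le.trans (by simp)
    have := h γ
    have := h (dual γ)
    omega
  | succ m ih =>
    obtain ⟨⟨p, γ⟩, rfl⟩ := decomposeFin.symm.surjective γ
    have h := ih γ
    obtain ⟨hz, ho, hl⟩ := dualLift_stats γ
    rw [card_cycles_decomposeFin_symm, dual_decomposeFin_symm]
    split_ifs with hp
    · subst hp
      rw [swap_self]
      change _ + #(cycles (1 * dualLift γ)) ≤ _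
      rw [one_mul]; omega
    · by_cases hs : (dualLift γ).SameCycle 0 p
      · have hp' := mem_cyc.mpr hs
        rw [← (pow_injOn_cyc (dualLift γ) 0).2] at hp'
        obtain ⟨i, hi, rfl⟩ := mem_image.mp hp'
        have hi0 : i ≠ 0 := by rintro rfl; simp at hp
        obtain ⟨h1, -⟩ := cut_stats (Nat.pos_of_ne_zero hi0) (mem_range.mp hi)
        rw [h1]; omega
      · have := (join_stats hs).1
        omega

end Insert

section Recurrences

/-- The number of `γ` of genus `g` whose dual has `b` cycles and `r` points outside the cycle
through the last point. -/
noncomputable def genusCount (g m b r : ℕ) : ℚ :=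
  ∑ γ : Perm (Fin (m + 1)), if #(cycles γ) + #(cycles (dual γ)) + 2 * g = m + 2 ∧
    #(cycles (dual γ)) = b ∧ outCard (dual γ) (Fin.last m) = r then 1 else 0

/-- The genus zero version of `genusCount` with a marked point lying on a cycle of length `l`
of the dual that avoids the last point. -/
noncomputable def markedCount (m b r l : ℕ) : ℚ :=
  ∑ γ : Perm (Fin (m + 1)), if #(cycles γ) + #(cycles (dual γ)) = m + 2 ∧
    #(cycles (dual γ)) = b ∧ outCard (dual γ) (Fin.last m) = r
    then (outCount (dual γ) (Fin.last m) l : ℚ) else 0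

lemma sum_range_ite_eq_add (o N r : ℕ) (h : ℕ → ℚ) :
    ∑ i ∈ range N, (if o + (i + 1) = r then h i else 0) =
      if o < r ∧ r ≤ o + N then h (r - o - 1) else 0 := by
  by_cases hr : o < r ∧ r ≤ o + N
  · rw [if_pos hr, sum_eq_single_of_mem (r - o - 1) (by rw [mem_range]; omega)]
    · rw [if_pos (by omega)]
    · intro i _ hi
      rw [if_neg (by omega)]
  · rw [if_neg hr]
    refine sum_eq_zero fun i hi => ?_
    rw [mem_range] at hi
    rw [if_neg (by omega)]

lemma sum_range_ite_and_eq (P Q : Prop) [Decidable P] [Decidable Q] (o r : ℕ) (c : ℚ) :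
    ∑ x ∈ range r, (if P ∧ Q ∧ o = x then c else 0) = if P ∧ Q ∧ o < r then c else 0 := by
  by_cases hP : P <;> by_cases hQ : Q <;> simp [hP, hQ]

lemma genusCount_zero_succ (m b r : ℕ) (hr : r ≤ m + 1) :
    genusCount 0 (m + 1) (b + 1) r =
      genusCount 0 m (b + 1) r + ∑ x ∈ range r, genusCount 0 m b x := by
  simp only [genusCount]
  rw [sum_perm_succ, sum_comm (s := range r), ← sum_add_distrib]
  refine sum_congr rfl fun γ _ => ?_
  rw [sum_range_ite_and_eq, sum_insert γ 0 (fun x y z _ =>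
    if x + y + 2 * 0 = m + 1 + 2 ∧ y = b + 1 ∧ z = r then 1 else 0)]
  have hle := card_cycles_add_le γ
  have hpos := card_cycles_pos (dual γ) 0
  have hlt := outCard_lt (dual γ) (Fin.last m)
  rw [Fintype.card_fin] at hlt
  rw [sum_eq_zero (s := (cyc (dualLift γ) 0)ᶜ) fun p _ => if_neg (by omega), add_zero]
  congr 1
  · exact if_congr (by omega) rfl rfl
  · by_cases h : #(cycles γ) + #(cycles (dual γ)) + 2 * 0 = m + 2 ∧ #(cycles (dual γ)) = b
    · rw [sum_congr rfl fun i _ => if_congr (Q := outCard (dual γ) (Fin.last m) + (i + 1) = r)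
        (by omega) rfl rfl, sum_range_ite_eq_add]
      exact if_congr (by omega) rfl rfl
    · rw [if_neg (by tauto)]
      exact sum_eq_zero fun i _ => if_neg (by omega)

lemma genusCount_one_succ (m b r : ℕ) (hr : r ≤ m + 1) :
    genusCount 1 (m + 1) (b + 1) r =
      genusCount 1 m (b + 1) r + ∑ x ∈ range r, genusCount 1 m b x +
        ∑ l ∈ range (m + 3), markedCount m (b + 2) (r + l) l := by
  simp only [genusCount, markedCount]
  rw [sum_perm_succ, sum_comm (s := range r), sum_comm (s := range (m + 3)), ← sum_add_distrib,
    ← sum_add_distrib]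
  refine sum_congr rfl fun γ _ => ?_
  rw [sum_range_ite_and_eq, sum_insert γ 0 (fun x y z _ =>
    if x + y + 2 * 1 = m + 1 + 2 ∧ y = b + 1 ∧ z = r then 1 else 0)]
  have hle := card_cycles_add_le γ
  have hpos := card_cycles_pos (dual γ) 0
  have hlt := outCard_lt (dual γ) (Fin.last m)
  rw [Fintype.card_fin] at hlt
  congr 1
  · congr 1
    · exact if_congr (by omega) rfl rfl
    · by_cases h : #(cycles γ) + #(cycles (dual γ)) + 2 * 1 = m + 2 ∧ #(cycles (dual γ)) = b
      · rw [sum_congr rfl fun i _ => if_congr (Q := outCard (dual γ) (Fin.last m) + (i + 1) = r)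
          (by omega) rfl rfl, sum_range_ite_eq_add]
        exact if_congr (by omega) rfl rfl
      · rw [if_neg (by tauto)]
        exact sum_eq_zero fun i _ => if_neg (by omega)
  · rw [sum_compl_cyc (dualLift γ) 0 (fun l => if #(cycles γ) + (#(cycles (dual γ)) - 1) + 2 * 1 =
      m + 1 + 2 ∧ #(cycles (dual γ)) - 1 = b + 1 ∧ outCard (dual γ) (Fin.last m) - l = r
      then 1 else 0), Fintype.card_fin]
    refine sum_congr rfl fun l _ => ?_
    rw [(dualLift_stats γ).2.2 l]
    by_cases h0 : outCount (dual γ) (Fin.last m) l = 0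
    · simp [h0]
    · have := le_outCard_of_outCount_ne_zero h0
      rw [mul_ite]
      exact if_congr (by omega) (mul_one _) (mul_zero _)

lemma markedCount_succ (m b r l : ℕ) (hr : r ≤ m + 1) (hl : 0 < l) :
    markedCount (m + 1) (b + 1) r l =
      markedCount m (b + 1) r l + ∑ x ∈ range r, markedCount m b x l +
        if l ≤ r then l * genusCount 0 m b (r - l) else 0 := by
  simp only [genusCount, markedCount]
  rw [sum_perm_succ, sum_comm (s := range r), ← sum_add_distrib]
  have : (if l ≤ r then (l : ℚ) * ∑ γ : Perm (Fin (m + 1)),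
      (if #(cycles γ) + #(cycles (dual γ)) + 2 * 0 = m + 2 ∧
      #(cycles (dual γ)) = b ∧ outCard (dual γ) (Fin.last m) = r - l then (1 : ℚ) else 0) else 0) =
      ∑ γ : Perm (Fin (m + 1)), if #(cycles γ) + #(cycles (dual γ)) = m + 2 ∧
      #(cycles (dual γ)) = b ∧ outCard (dual γ) (Fin.last m) + l = r then (l : ℚ) else 0 := by
    split_ifs with h
    · rw [mul_sum]
      refine sum_congr rfl fun γ _ => ?_
      rw [mul_ite]
      exact if_congr (by omega) (mul_one _) (mul_zero _)
    · exact (sum_eq_zero fun γ _ => if_neg (by omega)).symm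
  rw [this, ← sum_add_distrib]
  refine sum_congr rfl fun γ _ => ?_
  rw [sum_range_ite_and_eq, sum_insert γ l (fun x y z c =>
    if x + y = m + 1 + 2 ∧ y = b + 1 ∧ z = r then (c : ℚ) else 0)]
  have hle := card_cycles_add_le γ
  have hpos := card_cycles_pos (dual γ) 0
  have hlt := outCard_lt (dual γ) (Fin.last m)
  rw [Fintype.card_fin] at hlt
  rw [sum_eq_zero (s := (cyc (dualLift γ) 0)ᶜ) fun p _ => if_neg (by omega), add_zero]
  refine (congrArg₂ (· + ·) ?_ ?_).trans (add_assoc _ _ _).symm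
  · exact if_congr (by omega) rfl rfl
  · by_cases h : #(cycles γ) + #(cycles (dual γ)) = m + 2 ∧ #(cycles (dual γ)) = b
    · rw [sum_congr rfl fun i _ => if_congr (Q := outCard (dual γ) (Fin.last m) + (i + 1) = r)
        (by omega) rfl rfl, sum_range_ite_eq_add]
      by_cases hor : outCard (dual γ) (Fin.last m) < r
      · have hN : outCard (dual γ) (Fin.last m) < r ∧ r ≤ outCard (dual γ) (Fin.last m) +
            (m + 1 - outCard (dual γ) (Fin.last m)) := by omega
        have hP : #(cycles γ) + #(cycles (dual γ)) = m + 2 ∧ #(cycles (dual γ)) = b ∧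
            outCard (dual γ) (Fin.last m) < r := ⟨h.1, h.2, hor⟩
        rw [if_pos hN, if_pos hP, Nat.cast_add]
        refine congrArg (((outCount (dual γ) (Fin.last m) l : ℕ) : ℚ) + ·) ?_
        rw [Nat.cast_ite, Nat.cast_zero]
        refine if_ctx_congr (by omega) (fun hlr => ?_) fun _ => rfl
        exact congrArg _ (by omega)
      · rw [if_neg (fun hN => hor hN.1), if_neg (fun hN => hor hN.2.2), if_neg (by omega), add_zero]
    · rw [if_neg (by tauto), if_neg (by tauto), add_zero]
      exact sum_eq_zero fun i _ => if_neg (by omega)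

lemma genusCount_eq_zero_of_lt {g m b r : ℕ} (hr : m < r) : genusCount g m b r = 0 := by
  refine sum_eq_zero fun γ _ => if_neg ?_
  have hlt := outCard_lt (dual γ) (Fin.last m)
  rw [Fintype.card_fin] at hlt
  omega

lemma genusCount_zero_cycles (g m r : ℕ) : genusCount g m 0 r = 0 := by
  refine sum_eq_zero fun γ _ => if_neg ?_
  have hpos := card_cycles_pos (dual γ) 0
  omega

lemma markedCount_eq_zero_of_lt {m b r l : ℕ} (hr : m < r) : markedCount m b r l = 0 := by
  refine sum_eq_zero fun γ _ => if_neg ?_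
  have hlt := outCard_lt (dual γ) (Fin.last m)
  rw [Fintype.card_fin] at hlt
  omega

lemma markedCount_eq_zero_of_lt_length {m b r l : ℕ} (hr : r < l) : markedCount m b r l = 0 := by
  refine sum_eq_zero fun γ _ => ?_
  by_cases h0 : outCount (dual γ) (Fin.last m) l = 0
  · simp [h0]
  · have := le_outCard_of_outCount_ne_zero h0
    exact if_neg (by omega)

lemma markedCount_zero_cycles (m r l : ℕ) : markedCount m 0 r l = 0 := by
  refine sum_eq_zero fun γ _ => if_neg ?_
  have hpos := card_cycles_pos (dual γ) 0
  omega

lemma markedCount_zero_length (m b r : ℕ) : markedCount m b r 0 = 0 :=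
  sum_eq_zero fun γ _ => by simp [outCount_zero]

lemma card_cycles_fin_one (σ : Perm (Fin (0 + 1))) : #(cycles σ) = 1 :=
  le_antisymm (card_image_le.trans (by simp)) (card_cycles_pos σ 0)

lemma genusCount_base (g b r : ℕ) :
    genusCount g 0 b r = if g = 0 ∧ b = 1 ∧ r = 0 then 1 else 0 := by
  have h : ∀ γ : Perm (Fin (0 + 1)), outCard (dual γ) (Fin.last 0) = 0 := fun γ => by
    have := outCard_lt (dual γ) (Fin.last 0)
    rw [Fintype.card_fin] at this
    omega
  simp only [genusCount, card_cycles_fin_one, h, sum_const, card_univ]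
  rw [show Fintype.card (Perm (Fin (0 + 1))) = 1 from rfl, one_smul]
  exact if_congr (by omega) rfl rfl

lemma markedCount_base (b r l : ℕ) : markedCount 0 b r l = 0 := by
  refine sum_eq_zero fun γ _ => ?_
  have := outCard_lt (dual γ) (Fin.last 0)
  rw [Fintype.card_fin] at this
  by_cases h0 : outCount (dual γ) (Fin.last 0) l = 0
  · rw [h0, Nat.cast_zero, ite_self]
  · have := le_outCard_of_outCount_ne_zero h0
    have : l ≠ 0 := by rintro rfl; exact h0 (outCount_zero _ _)
    omega

end Recurrences

section ClosedForms

/-- The number of compositions of `r` into `j` positive parts. -/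
def compositionCount : ℕ → ℕ → ℕ
  | 0, 0 => 1
  | 0, _ + 1 => 0
  | _ + 1, 0 => 0
  | r + 1, j + 1 => compositionCount r j + compositionCount r (j + 1)

lemma compositionCount_succ_succ (r j : ℕ) :
    (compositionCount (r + 1) (j + 1) : ℚ) =
      compositionCount r j + compositionCount r (j + 1) := by
  rw [compositionCount, Nat.cast_add]

lemma mul_compositionCount_succ (r j : ℕ) :
    (j : ℚ) * compositionCount r (j + 1) = (r - j) * compositionCount r j := by
  induction r generalizing j with
  | zero => cases j <;> simp [compositionCount]
  | succ r ih =>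
    cases j with
    | zero => simp [compositionCount]
    | succ j =>
      have h0 := ih j
      have h1 := ih (j + 1)
      rw [compositionCount_succ_succ, compositionCount_succ_succ]
      push_cast at h1 ⊢
      linear_combination h1 + h0

lemma compositionCount_succ_succ_eq_choose (r j : ℕ) :
    compositionCount (r + 1) (j + 1) = r.choose j := by
  induction r generalizing j with
  | zero => cases j <;> simp [compositionCount]
  | succ r ih =>
    cases j with
    | zero => rw [compositionCount, ih]; simp [compositionCount]
    | succ j => rw [compositionCount, ih, ih, Nat.choose_succ_succ']

lemma cast_choose_succ_mul (n k : ℕ) :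
    ((n.choose (k + 1) : ℕ) : ℚ) * (k + 1) = n.choose k * (n - k) := by
  rcases le_or_gt k n with h | h
  · rw [← Nat.cast_sub h]
    exact_mod_cast Nat.choose_succ_right_eq n k
  · rw [Nat.choose_eq_zero_of_lt h, Nat.choose_eq_zero_of_lt (by omega)]
    simp

lemma cast_choose_succ_succ (n k : ℕ) :
    (((n + 1).choose (k + 1) : ℕ) : ℚ) = n.choose k + n.choose (k + 1) := by
  rw [Nat.choose_succ_succ', Nat.cast_add]

lemma sum_range_sub_mul_compositionCount (A : ℚ) (r j : ℕ) :
    (j + 1) * ∑ x ∈ range r, (A - x) * compositionCount x j =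
      (A + (A - r) * j) * compositionCount r (j + 1) := by
  induction r with
  | zero => simp [compositionCount]
  | succ r ih =>
    rw [sum_range_succ, mul_add, ih, compositionCount_succ_succ]
    push_cast
    linear_combination mul_compositionCount_succ r j

lemma succ_mul_genusCount_zero (m j r : ℕ) (hr : r ≤ m + 1) :
    (m + 1) * genusCount 0 m (j + 1) r = (m + 1 - r) * (m + 1).choose j * compositionCount r j := by
  induction m generalizing j r with
  | zero =>
    rw [genusCount_base]
    obtain rfl | rfl : r = 0 ∨ r = 1 := by omega
    · cases j <;> simp [compositionCount]
    · simp
  | succ m ih =>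
    rcases hr.eq_or_lt with rfl | hr'
    · rw [genusCount_eq_zero_of_lt (by omega)]
      push_cast
      ring
    have hm : (m + 1 : ℚ) ≠ 0 := by positivity
    have hle : r ≤ m + 1 := by omega
    rw [genusCount_zero_succ m j r hle]
    cases j with
    | zero =>
      have h := ih 0 r hle
      simp only [genusCount_zero_cycles, sum_const_zero, add_zero, Nat.choose_zero_right] at h ⊢
      refine mul_left_cancel₀ hm ?_
      cases r with
      | zero =>
        push_cast at h ⊢
        linear_combination (m + 2 : ℚ) * h
      | succ r =>
        simp only [compositionCount, Nat.cast_zero, mul_zero] at h ⊢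
        push_cast
        linear_combination (m + 2 : ℚ) * h
    | succ j =>
      have h := ih (j + 1) r hle
      have hs : (m + 1) * ∑ x ∈ range r, genusCount 0 m (j + 1) x =
          (m + 1).choose j * ∑ x ∈ range r, ((m + 1 : ℚ) - x) * compositionCount x j := by
        rw [mul_sum, mul_sum]
        refine sum_congr rfl fun x hx => ?_
        rw [mem_range] at hx
        rw [ih j x (by omega)]
        ring
      have ht := sum_range_sub_mul_compositionCount (m + 1) r j
      have hc := cast_choose_succ_mul (m + 1) j
      have hj : (j + 1 : ℚ) ≠ 0 := by positivity
      rw [cast_choose_succ_succ]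
      refine mul_left_cancel₀ hm (mul_left_cancel₀ hj ?_)
      push_cast at hc h ⊢
      linear_combination (j + 1 : ℚ) * (m + 2) * h + (j + 1 : ℚ) * (m + 2) * hs +
        (m + 2 : ℚ) * (m + 1).choose j * ht +
        ((m + 2 : ℚ) * (m + 1 - r) - (m + 1) * (m + 2 - r)) *
          compositionCount r (j + 1) * hc

lemma markedCount_one (m r l : ℕ) (hr : r ≤ m + 1) : markedCount m 1 r l = 0 := by
  induction m generalizing r with
  | zero => exact markedCount_base _ _ _
  | succ m ih =>
    rcases hr.eq_or_lt with rfl | hr'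
    · exact markedCount_eq_zero_of_lt (by omega)
    rcases l.eq_zero_or_pos with rfl | hl
    · exact markedCount_zero_length _ _ _
    rw [markedCount_succ m 0 r l (by omega) hl, ih r (by omega)]
    simp [markedCount_zero_cycles, genusCount_zero_cycles]

lemma markedCount_eq (m j t l : ℕ) (ht : t + l ≤ m + 1) :
    markedCount m (j + 2) (t + l) l =
      (m + 1 - t - l) * l * m.choose j * compositionCount t j := by
  rcases l.eq_zero_or_pos with rfl | hl
  · simp [markedCount_zero_length]
  induction m generalizing j t with
  | zero =>
    rw [markedCount_base]
    obtain ⟨rfl, rfl⟩ : t = 0 ∧ l = 1 := by omega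
    simp
  | succ m ih =>
    rcases ht.eq_or_lt with ht' | ht'
    · rw [markedCount_eq_zero_of_lt (by omega)]
      have : (t : ℚ) + l = m + 1 + 1 := by exact_mod_cast ht'
      push_cast
      linear_combination ((l : ℚ) * (m + 1).choose j * compositionCount t j) * this
    have hle : t + l ≤ m + 1 := by omega
    have hm : (m + 1 : ℚ) ≠ 0 := by positivity
    have hg := succ_mul_genusCount_zero m j t (by omega)
    rw [markedCount_succ m (j + 1) (t + l) l hle hl, ih j t hle, if_pos (by omega),
      Nat.add_sub_cancel]
    have hs : ∑ x ∈ range (t + l), markedCount m (j + 1) x l =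
        ∑ x ∈ range t, markedCount m (j + 1) (x + l) l := by
      rw [add_comm t l, sum_range_add, sum_eq_zero fun x hx =>
        markedCount_eq_zero_of_lt_length (mem_range.mp hx), zero_add]
      exact sum_congr rfl fun x _ => by rw [add_comm l x]
    rw [hs]
    cases j with
    | zero =>
      rw [sum_eq_zero fun x hx => markedCount_one m (x + l) l (by
        rw [mem_range] at hx; omega)]
      refine mul_left_cancel₀ hm ?_
      simp only [Nat.choose_zero_right] at hg ⊢
      cases t with
      | zero =>
        push_cast at hg ⊢
        linear_combination (l : ℚ) * hg
      | succ t =>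
        simp only [compositionCount, Nat.cast_zero, mul_zero] at hg ⊢
        linear_combination (l : ℚ) * hg
    | succ j =>
      have hs' : ∑ x ∈ range t, markedCount m (j + 2) (x + l) l =
          l * m.choose j * ∑ x ∈ range t, ((m + 1 - l : ℚ) - x) * compositionCount x j := by
        rw [mul_sum]
        refine sum_congr rfl fun x hx => ?_
        rw [mem_range] at hx
        rw [ih j x (by omega)]
        ring
      have ht := sum_range_sub_mul_compositionCount (m + 1 - l) t j
      have hc := cast_choose_succ_mul m j
      have hj : (j + 1 : ℚ) ≠ 0 := by positivity
      rw [hs', cast_choose_succ_succ]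
      rw [cast_choose_succ_succ] at hg
      refine mul_left_cancel₀ hm (mul_left_cancel₀ hj ?_)
      push_cast at hg ⊢
      linear_combination (l : ℚ) * (j + 1) * hg + (l : ℚ) * m.choose j * (m + 1) * ht -
        (l : ℚ) * t * compositionCount t (j + 1) * hc

lemma sum_range_sub_mul_self (s : ℕ) :
    ∑ l ∈ range (s + 1), ((s : ℚ) - l) * l = (s + 1) * s * (s - 1) / 6 := by
  have h : ∀ (a : ℚ) (k : ℕ), ∑ l ∈ range (k + 1), (a - l) * l =
      a * (k * (k + 1) / 2) - k * (k + 1) * (2 * k + 1) / 6 := fun a k => by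
    induction k with
    | zero => simp
    | succ k ih =>
      rw [sum_range_succ, ih]
      push_cast
      ring
  rw [h]
  ring

lemma sum_markedCount (m j r s : ℕ) (hs : r + s = m + 1) :
    ∑ l ∈ range (m + 3), markedCount m (j + 2) (r + l) l =
      (s + 1) * s * (s - 1) / 6 * m.choose j * compositionCount r j := by
  have hr : (m + 1 : ℚ) = r + s := by exact_mod_cast hs.symm
  rw [← sum_range_sub_mul_self, show m + 3 = (s + 1) + (r + 1) by omega, sum_range_add,
    sum_eq_zero (s := range (r + 1)) fun x _ => markedCount_eq_zero_of_lt (by omega), add_zero,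
    sum_mul, sum_mul]
  refine sum_congr rfl fun l hl => ?_
  rw [mem_range] at hl
  rw [markedCount_eq m j r l (by omega), hr]
  ring

lemma sum_range_cubic_mul_compositionCount (n : ℚ) (r j : ℕ) :
    (j + 2) * ∑ x ∈ range r, (n - x) * compositionCount x j *
        ((j + 1) * ((n - x) ^ 2 - x - n - 2) + 2 * x * (x + 1)) =
      (n * (n + 1 - r) * ((j + 2) * ((n + 1 - r) ^ 2 - r - n - 3) + 2 * r * (r + 1)) -
        (n - 2 - j) * (n - r) * ((j + 2) * ((n - r) ^ 2 - r - n - 2) + 2 * r * (r + 1)) -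
        4 * (n - r + 1) * (n - r) * (n - r - 1) * (j + 2)) * compositionCount r (j + 1) := by
  induction r with
  | zero => simp [compositionCount]
  | succ r ih =>
    rw [sum_range_succ, mul_add, ih, compositionCount_succ_succ]
    push_cast
    linear_combination -(4 + 4 * n - 6 * n ^ 2 - 2 * r + 10 * n * r - 6 * r ^ 2 + 2 * j +
      3 * n * j - 3 * n ^ 2 * j - r * j + 6 * n * r * j - 3 * r ^ 2 * j) * mul_compositionCount_succ r j

lemma genusCount_one_eq (m j r : ℕ) (hr : r ≤ m + 1) :
    24 * genusCount 1 m (j + 1) r = (m + 1 - r) * m.choose (j + 1) * compositionCount r j *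
      ((j + 1) * ((m + 1 - r) ^ 2 - r - (m + 1) - 2) + 2 * r * (r + 1)) := by
  induction m generalizing j r with
  | zero => simp [genusCount_base]
  | succ m ih =>
    rcases hr.eq_or_lt with rfl | hr'
    · rw [genusCount_eq_zero_of_lt (by omega)]
      push_cast
      ring
    have hle : r ≤ m + 1 := by omega
    have h := ih j r hle
    rw [genusCount_one_succ m j r hle, sum_markedCount m j r (m + 1 - r) (by omega),
      Nat.cast_sub hle]
    cases j with
    | zero =>
      simp only [genusCount_zero_cycles, sum_const_zero, add_zero, Nat.choose_zero_right, zero_add,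
        Nat.choose_one_right] at h ⊢
      cases r with
      | zero =>
        push_cast at h ⊢
        linear_combination h
      | succ r =>
        simp only [compositionCount, Nat.cast_zero, mul_zero, zero_mul] at h ⊢
        linear_combination h
    | succ j =>
      have hs : 24 * ∑ x ∈ range r, genusCount 1 m (j + 1) x =
          m.choose (j + 1) * ∑ x ∈ range r, ((m + 1 : ℚ) - x) * compositionCount x j *
            ((j + 1) * (((m + 1 : ℚ) - x) ^ 2 - x - (m + 1) - 2) + 2 * x * (x + 1)) := by
        rw [mul_sum, mul_sum]
        refine sum_congr rfl fun x hx => ?_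
        rw [mem_range] at hx
        rw [ih j x (by omega)]
        ring
      have ht := sum_range_cubic_mul_compositionCount (m + 1) r j
      have hc := cast_choose_succ_mul m (j + 1)
      have hj : (j + 2 : ℚ) ≠ 0 := by positivity
      rw [cast_choose_succ_succ]
      refine mul_left_cancel₀ hj ?_
      push_cast at h hc ⊢
      linear_combination (j + 2 : ℚ) * h + (j + 2 : ℚ) * hs + (m.choose (j + 1) : ℚ) * ht +
        compositionCount r (j + 1) *
          (((m : ℚ) + 1 - r) * ((j + 2) * ((m + 1 - r) ^ 2 - r - m - 3) + 2 * r * (r + 1)) -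
            (m + 2 - r) * ((j + 2) * ((m + 2 - r) ^ 2 - r - m - 4) + 2 * r * (r + 1))) * hc

lemma sum_genusCount_one (m j : ℕ) :
    6 * ∑ r ∈ range (m + 1), genusCount 1 m (j + 1) r =
      (m + 2).choose 2 * m.choose j * m.choose (j + 2) := by
  have h := genusCount_one_succ m (j + 1) (m + 1) le_rfl
  rw [genusCount_eq_zero_of_lt (m := m) (by omega), zero_add,
    sum_eq_zero (s := range (m + 3)) fun l _ => markedCount_eq_zero_of_lt (by omega), add_zero] at h
  have he := genusCount_one_eq (m + 1) (j + 1) (m + 1) (by omega)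
  rw [compositionCount_succ_succ_eq_choose, cast_choose_succ_succ] at he
  have hc := cast_choose_succ_mul m (j + 1)
  rw [← h, Nat.cast_choose_two]
  push_cast at he hc ⊢
  linear_combination (1 / 4 : ℚ) * he - (1 / 2 : ℚ) * (m + 2) * m.choose j * hc

end ClosedForms

section Counting

lemma zPerm_eq {n : ℕ} (α : Perm (Fin n)) : zPerm α = #(cycles α) := card_quotient_sameCycle α

lemma cycles_inv {n : ℕ} (α : Perm (Fin n)) : cycles α⁻¹ = cycles α := by
  have h : cyc α⁻¹ = cyc α := by
    ext a x
    simp [sameCycle_inv]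
  rw [cycles, h, cycles]

lemma card_isGenusOne (m k : ℕ) :
    (Nat.card {α : Perm (Fin (m + 1)) // IsGenusOne α ∧ zPerm α = k} : ℚ) =
      ∑ γ : Perm (Fin (m + 1)), if #(cycles γ) + #(cycles (dual γ)) + 2 = m + 2 ∧
        #(cycles γ) = k then 1 else 0 := by
  have e : {α : Perm (Fin (m + 1)) // IsGenusOne α ∧ zPerm α = k} ≃
      {γ : Perm (Fin (m + 1)) // #(cycles γ) + #(cycles (dual γ)) + 2 = m + 2 ∧
        #(cycles γ) = k} :=
    (Equiv.inv _).subtypeEquiv fun α => by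
      rw [IsGenusOne, zPerm_eq, zPerm_eq, Equiv.inv_apply, cycles_inv]
  rw [Nat.card_congr e, Nat.card_eq_fintype_card, Fintype.card_subtype, card_filter, Nat.cast_sum]
  simp only [Nat.cast_ite, Nat.cast_one, Nat.cast_zero]

lemma six_mul_card_isGenusOne (m k : ℕ) (hk : 1 ≤ k) :
    6 * Nat.card {α : Perm (Fin (m + 1)) // IsGenusOne α ∧ zPerm α = k} =
      (m + 1 + 1).choose 2 * m.choose (k + 1) * m.choose (k - 1) := by
  rw [← Nat.cast_inj (R := ℚ), Nat.cast_mul, card_isGenusOne]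
  rcases le_or_gt m k with h | h
  · rw [Nat.choose_eq_zero_of_lt (n := m) (k := k + 1) (by omega), mul_zero, zero_mul,
      sum_eq_zero fun γ _ => ?_]
    · simp
    · have := card_cycles_pos (dual γ) 0
      exact if_neg (by omega)
  obtain ⟨j, hj⟩ : ∃ j, m = j + 1 + k := ⟨m - 1 - k, by omega⟩
  rw [← Nat.choose_symm (n := m) (k := k + 1) (by omega),
    ← Nat.choose_symm (n := m) (k := k - 1) (by omega), show m - (k + 1) = j by omega,
    show m - (k - 1) = j + 2 by omega]
  push_cast
  rw [← sum_genusCount_one m j]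
  congr 1
  simp only [genusCount]
  rw [sum_comm]
  refine sum_congr rfl fun γ _ => ?_
  rw [sum_range_ite_and_eq]
  have hlt := outCard_lt (dual γ) (Fin.last m)
  rw [Fintype.card_fin] at hlt
  exact if_congr (by omega) rfl rfl

end Counting

/-- For `n ≥ 1` and `k ≥ 1`, six times the number of genus-one permutations of
`{1,…,n}` with exactly `k` cycles equals `C(n+1,2)·C(n−1,k+1)·C(n−1,k−1)`. -/
theorem genus_one_permutation_count (n k : ℕ) (hn : 1 ≤ n) (hk : 1 ≤ k) :
    6 * Nat.card {α : Equiv.Perm (Fin n) // IsGenusOne α ∧ zPerm α = k} =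
      (n + 1).choose 2 * (n - 1).choose (k + 1) * (n - 1).choose (k - 1) := by
  obtain ⟨m, rfl⟩ := Nat.exists_eq_succ_of_ne_zero (Nat.one_le_iff_ne_zero.mp hn)
  exact six_mul_card_isGenusOne m k hk
end
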